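/- arXiv:1305.2810 — 4 statements merged into one kernel-verified Lean document; each statement's English description precedes it below -/
import Mathlib

section
/- Let S ⊆ ℝ² satisfy (H1), let r ∈ (0, r_S), let p ∈ S, and assume S ≠ {p}. Then the contact set C_r(p) consists either of exactly two antipodal points of ∂B_r(p) (i.e. two points a, b with a + b = 2p), or of a closed semicircumference of ∂B_r(p) (a closed arc of length exactly πr). -/
open Metric Set Real
open scoped RealInnerProductSpace

noncomputable section

abbrev E2 := EuclideanSpace ℝ (Fin 2)

/-- The contact set `C_r(p) = ∂B_r(p) ∩ ∂S_r = {y ∈ ∂S_r : |y − p| = r}`. -/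
def contactSet (S : Set E2) (r : ℝ) (p : E2) : Set E2 :=
  Metric.sphere p r ∩ frontier {x | infDist x S < r}

/-- `A` is a closed arc of the circle `∂B_r(p)` of length `L`: in a suitable orthonormal
frame `(u, v)`, it is the image of the angular interval `[0, L/r]` under the standard
parametrization of `∂B_r(p)`. -/
def IsClosedArc (p : E2) (r : ℝ) (A : Set E2) (L : ℝ) : Prop :=
  ∃ u v : E2, ‖u‖ = 1 ∧ ‖v‖ = 1 ∧ ⟪u, v⟫ = 0 ∧
    A = (fun θ : ℝ => p + (r * Real.cos θ) • u + (r * Real.sin θ) • v) '' Set.Icc 0 (L / r)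

open Filter Topology

section NormalVectors

variable {E : Type*} [NormedAddCommGroup E] [InnerProductSpace ℝ E]

/-- The unit vectors `n` such that `p` realises the distance from `p + r • n` to `S`. -/
def unitNormals (S : Set E) (r : ℝ) (p : E) : Set E :=
  {n | ‖n‖ = 1 ∧ infDist (p + r • n) S = r}

/-- A nearest-point condition expressed as a system of affine inequalities. -/
lemma infDist_add_eq_norm_iff {S : Set E} {p : E} (hp : p ∈ S) (w : E) :
    infDist (p + w) S = ‖w‖ ↔ ∀ b ∈ S, 2 * ⟪w, b - p⟫ ≤ ‖b - p‖ ^ 2 := by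
  have key : ∀ b, dist (p + w) b ^ 2 = ‖w‖ ^ 2 - 2 * ⟪w, b - p⟫ + ‖b - p‖ ^ 2 := by
    intro b
    rw [dist_eq_norm, show p + w - b = w - (b - p) by abel, norm_sub_sq_real]
  constructor
  · intro h b hb
    have h1 : ‖w‖ ≤ dist (p + w) b := h ▸ infDist_le_dist_of_mem hb
    have h2 := key b
    nlinarith [norm_nonneg w]
  · intro h
    apply le_antisymm
    · simpa using infDist_le_dist_of_mem (x := p + w) hp
    · rw [le_infDist ⟨p, hp⟩]
      intro b hb
      apply abs_le_of_sq_le_sq' _ dist_nonneg |>.2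
      rw [key b]
      linarith [h b hb]

lemma infDist_add_smul_of_le {S : Set E} {q n : E} {s t : ℝ} (hq : q ∈ S) (hn : ‖n‖ = 1)
    (h : infDist (q + s • n) S = s) (ht : 0 ≤ t) (hts : t ≤ s) :
    infDist (q + t • n) S = t := by
  apply le_antisymm
  · simpa [norm_smul, hn, abs_of_nonneg ht] using infDist_le_dist_of_mem (x := q + t • n) hq
  · have h1 := infDist_le_infDist_add_dist (s := S) (x := q + s • n) (y := q + t • n)
    have h2 : dist (q + s • n) (q + t • n) = s - t := by
      rw [dist_add_left, dist_eq_norm, ← sub_smul, norm_smul, hn, mul_one, Real.norm_eq_abs,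
        abs_of_nonneg (by linarith)]
    linarith

/-- Where it is differentiable, the distance function has as gradient the unit vector pointing
away from the nearest point. -/
lemma fderiv_infDist_apply {S : Set E} {q n : E} {s : ℝ} (hq : q ∈ S) (hn : ‖n‖ = 1)
    (hs : 0 < s) (h : infDist (q + s • n) S = s)
    (hd : DifferentiableAt ℝ (fun x => infDist x S) (q + s • n)) (v : E) :
    fderiv ℝ (fun x => infDist x S) (q + s • n) v = ⟪n, v⟫ := by
  set L := fderiv ℝ (fun x => infDist x S) (q + s • n) with hL
  have hnorm : ‖L‖ ≤ 1 := by
    simpa using norm_fderiv_le_of_lipschitz ℝ (lipschitz_infDist_pt S) (x₀ := q + s • n)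
  have hLn : L n = 1 := by
    have hline : HasDerivAt (fun t : ℝ => q + t • n) n s := by
      simpa using ((hasDerivAt_id s).smul_const n).const_add q
    have h1 : HasDerivAt (fun t : ℝ => infDist (q + t • n) S) (L n) s :=
      HasFDerivAt.comp_hasDerivAt s (l := fun x => infDist x S) hd.hasFDerivAt hline
    have h2 : HasDerivWithinAt (fun t : ℝ => infDist (q + t • n) S) 1 (Iic s) s := by
      refine (hasDerivWithinAt_id s (Iic s)).congr_of_eventuallyEq ?_ h
      filter_upwards [self_mem_nhdsWithin, mem_nhdsWithin_of_mem_nhds (lt_mem_nhds hs)]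
        with t ht ht0
      exact infDist_add_smul_of_le hq hn h ht0.le ht
    exact (uniqueDiffWithinAt_Iic s).eq_deriv _ h1.hasDerivWithinAt h2
  obtain ⟨c, hc⟩ : ∃ c, c = L v - ⟪n, v⟫ := ⟨_, rfl⟩
  have hbound : ∀ t : ℝ, 2 * t * c ≤ t ^ 2 * (‖v‖ ^ 2 - ⟪n, v⟫ ^ 2) := by
    intro t
    have h1 : L (n + t • (v - ⟪n, v⟫ • n)) ≤ ‖n + t • (v - ⟪n, v⟫ • n)‖ :=
      (le_abs_self _).trans ((L.le_opNorm _).trans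
        (mul_le_of_le_one_left (norm_nonneg _) hnorm))
    have h2 : L (n + t • (v - ⟪n, v⟫ • n)) = 1 + t * c := by
      simp [hLn, hc]
    have h3 : ‖n + t • (v - ⟪n, v⟫ • n)‖ ^ 2 = 1 + t ^ 2 * (‖v‖ ^ 2 - ⟪n, v⟫ ^ 2) := by
      rw [← real_inner_self_eq_norm_sq, ← real_inner_self_eq_norm_sq]
      have := real_inner_self_eq_norm_sq n
      rw [hn] at this
      simp only [inner_add_left, inner_add_right, inner_sub_left, inner_sub_right,
        real_inner_smul_left, real_inner_smul_right, real_inner_comm n v, this]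
      ring
    rw [h2] at h1
    by_cases h0 : 0 ≤ 1 + t * c
    · nlinarith [sq_nonneg (t * c)]
    · nlinarith [sq_nonneg (1 + t * c), sq_nonneg (‖n + t • (v - ⟪n, v⟫ • n)‖)]
  have hc0 : c = 0 := by
    by_contra hne
    obtain ⟨D, hD⟩ : ∃ D, D = ‖v‖ ^ 2 - ⟪n, v⟫ ^ 2 := ⟨_, rfl⟩
    rw [← hD] at hbound
    have hD1 : (0 : ℝ) < |D| + 1 := by positivity
    have := hbound (c / (|D| + 1))
    have hc2 : 0 < c ^ 2 := by positivity
    rw [div_pow, div_mul_eq_mul_div, mul_div_assoc', div_mul_eq_mul_div,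
      div_le_div_iff₀ hD1 (by positivity)] at this
    nlinarith [le_abs_self D, mul_pos hc2 hD1, mul_nonneg hc2.le (abs_nonneg D)]
  linarith

variable [ProperSpace E]

lemma exists_mem_add_smul_eq {S : Set E} (hcl : IsClosed S) (hne : S.Nonempty) {x : E}
    (hx : 0 < infDist x S) :
    ∃ q ∈ S, ∃ n : E, ‖n‖ = 1 ∧ x = q + infDist x S • n := by
  obtain ⟨q, hq, hqx⟩ := hcl.exists_infDist_eq_dist hne x
  refine ⟨q, hq, (infDist x S)⁻¹ • (x - q), ?_, ?_⟩
  · rw [norm_smul, ← dist_eq_norm, ← hqx, norm_inv, Real.norm_eq_abs, abs_of_pos hx,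
      inv_mul_cancel₀ hx.ne']
  · rw [smul_inv_smul₀ hx.ne']
    abel

lemma infDist_add_smul_add {S : Set E} (hcl : IsClosed S) {R : ℝ}
    (hd : ∀ x, 0 < infDist x S → infDist x S < R → DifferentiableAt ℝ (fun x => infDist x S) x)
    {q n : E} {s h : ℝ} (hq : q ∈ S) (hn : ‖n‖ = 1) (hh : 0 ≤ h) (hhs : h < s)
    (hsR : s + h < R) (hs : infDist (q + s • n) S = s) :
    infDist (q + (s + h) • n) S = s + h := by
  obtain ⟨x, hx⟩ : ∃ x, x = q + s • n := ⟨_, rfl⟩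
  have hs0 : 0 < s := hh.trans_lt hhs
  have hcont := continuous_infDist_pt S
  obtain ⟨y, hy, hmax⟩ := (isCompact_closedBall x h).exists_isMaxOn
    (nonempty_closedBall.2 hh) hcont.continuousOn
  have hxs : infDist x S = s := by rw [hx, hs]
  have hyx : ‖y - x‖ ≤ h := by rwa [← dist_eq_norm]
  have hsy : s ≤ infDist y S := hxs ▸ hmax (mem_closedBall_self hh)
  have hys : infDist y S ≤ s + h := by
    have := infDist_le_infDist_add_dist (s := S) (x := y) (y := x)
    rw [dist_eq_norm] at this
    linarith
  have hy0 : 0 < infDist y S := by linarith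
  obtain ⟨q', hq', u, hu, hyu⟩ := exists_mem_add_smul_eq hcl ⟨q, hq⟩ hy0
  have hyd := hd y hy0 (by linarith)
  have hgrad : ∀ v, fderiv ℝ (fun x => infDist x S) y v = ⟪u, v⟫ := by
    intro v
    obtain ⟨d, hdd⟩ : ∃ d, d = infDist y S := ⟨_, rfl⟩
    rw [← hdd] at hyu hy0
    subst hyu
    exact fderiv_infDist_apply hq' hu hy0 hdd.symm hyd v
  have hz : x + h • u ∈ closedBall x h := by
    simp [norm_smul, hu, abs_of_nonneg hh]
  have hle : ⟪u, x + h • u - y⟫ ≤ 0 := by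
    rw [← hgrad]
    exact hmax.localize.hasFDerivWithinAt_nonpos hyd.hasFDerivAt.hasFDerivWithinAt
      (sub_mem_posTangentConeAt_of_segment_subset
        ((convex_closedBall x h).segment_subset hy hz))
  have hyeq : y = x + h • u := by
    have h1 : ⟪u, y - x⟫ ≥ h := by
      have : x + h • u - y = h • u - (y - x) := by abel
      rw [this, inner_sub_right, real_inner_smul_right, real_inner_self_eq_norm_sq, hu] at hle
      linarith
    have h2 : ‖(y - x) - h • u‖ ^ 2 ≤ 0 := by
      rw [norm_sub_sq_real, real_inner_smul_right, norm_smul, hu, real_inner_comm,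
        Real.norm_eq_abs, mul_one, sq_abs]
      nlinarith [norm_nonneg (y - x)]
    have h3 : (y - x) - h • u = 0 := by
      rw [← norm_eq_zero]
      exact pow_eq_zero_iff two_ne_zero |>.1 (le_antisymm h2 (sq_nonneg _))
    rw [sub_eq_zero] at h3
    rw [← h3]
    abel
  have hxu : x = q' + (infDist y S - h) • u := by
    rw [sub_smul, ← add_sub_assoc, ← hyu, hyeq]
    abel
  have hyh : infDist y S = s + h := by
    have h1 := infDist_add_smul_of_le hq' hu (s := infDist y S) (t := infDist y S - h)
      (by rw [← hyu]) (by linarith) (by linarith)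
    rw [← hxu] at h1
    linarith
  have hxu' : x = q' + s • u := by rw [hxu, hyh, add_sub_cancel_right]
  have hnu : n = u := by
    have hxd := hd x (by linarith) (by linarith)
    have h1 := fderiv_infDist_apply hq hn hs0 hs (hx ▸ hxd)
    have h2 := fderiv_infDist_apply hq' hu hs0 (hxu' ▸ hxs) (hxu' ▸ hxd)
    rw [← hx] at h1
    rw [← hxu'] at h2
    exact ext_inner_right ℝ fun v => by rw [← h1, ← h2]
  rw [add_smul, ← add_assoc, ← hx, hnu, ← hyeq, hyh]

/-- If the distance function of `S` is differentiable at distances in `(0, R)`, then proximal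
normal segments can be prolonged up to length `R`. -/
lemma infDist_add_smul_of_lt {S : Set E} (hcl : IsClosed S) {R : ℝ}
    (hd : ∀ x, 0 < infDist x S → infDist x S < R → DifferentiableAt ℝ (fun x => infDist x S) x)
    {q n : E} {s t : ℝ} (hq : q ∈ S) (hn : ‖n‖ = 1) (hs0 : 0 < s)
    (hs : infDist (q + s • n) S = s) (ht : 0 ≤ t) (htR : t < R) :
    infDist (q + t • n) S = t := by
  rcases le_total t s with hts | hst
  · exact infDist_add_smul_of_le hq hn hs ht hts
  have hclosed : IsClosed ({t : ℝ | infDist (q + t • n) S = t} ∩ Icc s t) :=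
    (isClosed_eq ((continuous_infDist_pt S).comp (by fun_prop)) continuous_id).inter isClosed_Icc
  refine hclosed.Icc_subset_of_forall_exists_gt hs ?_ (right_mem_Icc.2 hst)
  rintro a ⟨ha, has, hat⟩ b hb
  have hab : a < b := hb
  obtain ⟨h, hh0, hh⟩ : ∃ h, 0 < h ∧ h < min (min a (R - a)) (b - a) :=
    exists_between (by simp only [lt_min_iff]; refine ⟨⟨?_, ?_⟩, ?_⟩ <;> linarith)
  simp only [lt_min_iff] at hh
  exact ⟨a + h, infDist_add_smul_add hcl hd hq hn hh0.le hh.1.1 (by linarith [hh.1.2]) ha,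
    by linarith, by linarith [hh.2]⟩

/-- The set of unit normals spans a convex cone. -/
lemma smul_add_smul_mem_unitNormals {S : Set E} (hcl : IsClosed S) {R r : ℝ}
    (hd : ∀ x, 0 < infDist x S → infDist x S < R → DifferentiableAt ℝ (fun x => infDist x S) x)
    (hr : r ∈ Ioo 0 R) {p m n : E} (hp : p ∈ S) (hm : m ∈ unitNormals S r p)
    (hn : n ∈ unitNormals S r p) {a b : ℝ} (ha : 0 ≤ a) (hb : 0 ≤ b)
    (hab : ‖a • m + b • n‖ = 1) : a • m + b • n ∈ unitNormals S r p := by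
  refine ⟨hab, ?_⟩
  have hineq : ∀ n ∈ unitNormals S r p, ∀ c ∈ S, 2 * (r * ⟪n, c - p⟫) ≤ ‖c - p‖ ^ 2 := by
    rintro n ⟨hn1, hn2⟩
    have hw : ‖r • n‖ = r := by simp [norm_smul, hn1, abs_of_pos hr.1]
    simpa only [real_inner_smul_left] using
      (infDist_add_eq_norm_iff hp (r • n)).1 (hn2.trans hw.symm)
  have hpos : 0 < a + b := by
    by_contra hcon
    have h1 : a = 0 := by linarith
    have h2 : b = 0 := by linarith
    simp [h1, h2] at hab
  have hs0 : 0 < r / (a + b) := div_pos hr.1 hpos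
  refine infDist_add_smul_of_lt hcl hd hp hab hs0 ?_ hr.1.le hr.2
  have hw : ‖(r / (a + b)) • (a • m + b • n)‖ = r / (a + b) := by
    rw [norm_smul, hab, mul_one, Real.norm_eq_abs, abs_of_pos hs0]
  refine ((infDist_add_eq_norm_iff hp _).2 fun c hc => ?_).trans hw
  have h1 := mul_le_mul_of_nonneg_left (hineq m hm c hc) ha
  have h2 := mul_le_mul_of_nonneg_left (hineq n hn c hc) hb
  simp only [real_inner_smul_left, inner_add_left]
  have : 2 * (r / (a + b) * (a * ⟪m, c - p⟫ + b * ⟪n, c - p⟫)) =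
      (a * (2 * (r * ⟪m, c - p⟫)) + b * (2 * (r * ⟪n, c - p⟫))) / (a + b) := by
    field_simp
  rw [this, div_le_iff₀ hpos]
  linarith

lemma isCompact_unitNormals (S : Set E) (r : ℝ) (p : E) : IsCompact (unitNormals S r p) := by
  have : unitNormals S r p = sphere 0 1 ∩ {n | infDist (p + r • n) S = r} := by
    ext n
    simp [unitNormals]
  rw [this]
  exact (isCompact_sphere 0 1).inter_right
    (isClosed_eq ((continuous_infDist_pt S).comp (by fun_prop)) continuous_const)

/-- In a set with empty interior, every direction makes a nonobtuse angle with some normal. -/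
lemma exists_mem_unitNormals_inner_nonneg {S : Set E} (hcl : IsClosed S) (hint : interior S = ∅)
    {R r : ℝ}
    (hd : ∀ x, 0 < infDist x S → infDist x S < R → DifferentiableAt ℝ (fun x => infDist x S) x)
    (hr : r ∈ Ioo 0 R) {p : E} (hp : p ∈ S) (v : E) :
    ∃ n ∈ unitNormals S r p, 0 ≤ ⟪n, v⟫ := by
  have hne : S.Nonempty := ⟨p, hp⟩
  have approx : ∀ ε > 0, ∃ q ∈ S, dist q p < ε ∧ ∃ n ∈ unitNormals S r q, -ε < ⟪n, v⟫ := by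
    intro ε hε
    have e1 : ∀ᶠ t : ℝ in 𝓝[>] 0, t * (‖v‖ + t) < R :=
      nhdsWithin_le_nhds <| (Continuous.tendsto' (by fun_prop) 0 0 (by simp)).eventually
        (gt_mem_nhds (hr.1.trans hr.2))
    have e2 : ∀ᶠ t : ℝ in 𝓝[>] 0, 2 * (t * (‖v‖ + t)) < ε :=
      nhdsWithin_le_nhds <| (Continuous.tendsto' (by fun_prop) 0 0 (by simp)).eventually
        (gt_mem_nhds hε)
    have e3 : ∀ᶠ t : ℝ in 𝓝[>] 0, t * (1 + 2 * (‖v‖ + t) ^ 2 / r) < ε :=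
      nhdsWithin_le_nhds <| (Continuous.tendsto' (by fun_prop) 0 0 (by simp)).eventually
        (gt_mem_nhds hε)
    obtain ⟨t, ⟨⟨h1, h2⟩, h3⟩, ht⟩ := (((e1.and e2).and e3).and self_mem_nhdsWithin).exists
    have ht0 : 0 < t := ht
    obtain ⟨x, hxt, hxS⟩ : ∃ x, dist x (p + t • v) < t ^ 2 ∧ x ∉ S := by
      by_contra! hcon
      have : p + t • v ∈ interior S :=
        mem_interior.2 ⟨ball (p + t • v) (t ^ 2), fun x hx => hcon x hx, isOpen_ball,
          mem_ball_self (by positivity)⟩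
      simp [hint] at this
    have hx0 : 0 < infDist x S := (hcl.notMem_iff_infDist_pos hne).1 hxS
    have hxp : dist x p ≤ t * (‖v‖ + t) := by
      have h4 := dist_triangle x (p + t • v) p
      have h5 : dist (p + t • v) p = t * ‖v‖ := by simp [norm_smul, abs_of_pos ht0]
      nlinarith
    have hxd : infDist x S ≤ dist x p := infDist_le_dist_of_mem hp
    obtain ⟨q, hq, n, hn, hxq⟩ := exists_mem_add_smul_eq hcl hne hx0
    have hqn : infDist (q + r • n) S = r :=
      infDist_add_smul_of_lt hcl hd hq hn hx0 (by rw [← hxq]) hr.1.le hr.2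
    have hxqd : dist x q = infDist x S := by
      conv_lhs => rw [hxq]
      simp [norm_smul, hn, abs_of_pos hx0]
    have hqp : dist q p ≤ 2 * (t * (‖v‖ + t)) := by
      linarith [dist_triangle_left q p x]
    refine ⟨q, hq, by linarith, n, ⟨hn, hqn⟩, ?_⟩
    have hw : ‖r • n‖ = r := by simp [norm_smul, hn, abs_of_pos hr.1]
    have hineq := (infDist_add_eq_norm_iff hq (r • n)).1 (hqn.trans hw.symm) p hp
    rw [real_inner_smul_left, ← dist_eq_norm, dist_comm] at hineq
    have hdec : ⟪n, p - q⟫ = infDist x S - t * ⟪n, v⟫ - ⟪n, x - (p + t • v)⟫ := by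
      have : p - q = infDist x S • n - t • v - (x - (p + t • v)) := by
        nth_rw 2 [hxq]
        abel
      rw [this, inner_sub_right, inner_sub_right, real_inner_smul_right, real_inner_smul_right,
        real_inner_self_eq_norm_sq, hn]
      ring
    have herr : ⟪n, x - (p + t • v)⟫ ≤ t ^ 2 := by
      have := real_inner_le_norm n (x - (p + t • v))
      rw [hn, one_mul, ← dist_eq_norm] at this
      linarith
    have hsq : dist q p ^ 2 ≤ (2 * (t * (‖v‖ + t))) ^ 2 := by gcongr
    have hr0 := hr.1
    have h6 : ⟪n, p - q⟫ ≤ 2 * (t * (‖v‖ + t)) ^ 2 / r := by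
      rw [le_div_iff₀ hr0]
      nlinarith
    have h7 : 0 ≤ t * (⟪n, v⟫ + t * (1 + 2 * (‖v‖ + t) ^ 2 / r)) := by
      have : t * (⟪n, v⟫ + t * (1 + 2 * (‖v‖ + t) ^ 2 / r)) =
        t * ⟪n, v⟫ + t ^ 2 + 2 * (t * (‖v‖ + t)) ^ 2 / r := by ring
      rw [this]
      linarith
    have h8 := nonneg_of_mul_nonneg_right h7 ht0
    linarith
  choose q _ hqp n hn hnv using fun k : ℕ => approx (1 / ((k : ℝ) + 1)) (by positivity)
  obtain ⟨m, hm, φ, hφ, hlim⟩ := (isCompact_sphere (0 : E) 1).tendsto_subseq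
    (fun k => mem_sphere_zero_iff_norm.2 (hn k).1)
  have hε : Tendsto (fun k => 1 / ((φ k : ℝ) + 1)) atTop (𝓝 0) :=
    tendsto_one_div_add_atTop_nhds_zero_nat.comp hφ.tendsto_atTop
  have hq : Tendsto (fun k => q (φ k)) atTop (𝓝 p) :=
    tendsto_iff_dist_tendsto_zero.2
      (squeeze_zero (fun _ => dist_nonneg) (fun k => (hqp (φ k)).le) hε)
  refine ⟨m, ⟨mem_sphere_zero_iff_norm.1 hm, ?_⟩, ?_⟩
  · refine tendsto_nhds_unique
      (((continuous_infDist_pt S).tendsto _).comp (hq.add (hlim.const_smul r))) ?_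
    exact tendsto_const_nhds.congr fun k => (hn (φ k)).2.symm
  · have h1 : Tendsto (fun k => ⟪n (φ k), v⟫) atTop (𝓝 ⟪m, v⟫) := hlim.inner tendsto_const_nhds
    have h2 := hε.neg
    rw [neg_zero] at h2
    exact le_of_tendsto_of_tendsto' h2 h1 fun k => (hnv (φ k)).le

end NormalVectors

/-- A connected set for which every unit vector is a normal at `p` is reduced to `p`. -/
lemma eq_singleton_of_forall_mem_unitNormals {E : Type*} [NormedAddCommGroup E]
    [InnerProductSpace ℝ E] {S : Set E} (hconn : IsPreconnected S) {r : ℝ} (hr : 0 < r) {p : E}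
    (hp : p ∈ S) (hall : ∀ n : E, ‖n‖ = 1 → n ∈ unitNormals S r p) : S = {p} := by
  have hfar : ∀ b ∈ S, b ≠ p → 2 * r ≤ dist b p := by
    intro b hb hbp
    have hpos : 0 < ‖b - p‖ := norm_pos_iff.2 (sub_ne_zero.2 hbp)
    have hu : ‖‖b - p‖⁻¹ • (b - p)‖ = 1 := by
      rw [norm_smul, norm_inv, norm_norm, inv_mul_cancel₀ hpos.ne']
    have hw : ‖r • ‖b - p‖⁻¹ • (b - p)‖ = r := by
      rw [norm_smul, hu, mul_one, Real.norm_eq_abs, abs_of_pos hr]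
    have h := (infDist_add_eq_norm_iff hp _).1 ((hall _ hu).2.trans hw.symm) b hb
    rw [real_inner_smul_left, real_inner_smul_left, real_inner_self_eq_norm_sq, sq,
      inv_mul_cancel_left₀ hpos.ne'] at h
    rw [dist_eq_norm]
    nlinarith
  refine eq_singleton_iff_unique_mem.2 ⟨hp, fun b hb => ?_⟩
  by_contra hbp
  have himg : IsPreconnected ((fun x => dist x p) '' S) :=
    hconn.image _ (by fun_prop)
  have hbr := hfar b hb hbp
  obtain ⟨c, hc, hcr⟩ := himg.ordConnected.out ⟨p, hp, dist_self p⟩ ⟨b, hb, rfl⟩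
    (show r ∈ Icc 0 (dist b p) from ⟨hr.le, by linarith⟩)
  have hcr' : dist c p = r := hcr
  have hcp : c ≠ p := by
    rintro rfl
    rw [dist_self] at hcr'
    linarith
  linarith [hfar c hc hcp]

/-- The contact set consists of the translates of the unit normals. -/
lemma contactSet_eq_image_unitNormals {S : Set E2} {r : ℝ} (hr : 0 < r) {p : E2} (hp : p ∈ S) :
    contactSet S r p = (fun n => p + r • n) '' unitNormals S r p := by
  have hcont := continuous_infDist_pt S
  ext y
  constructor
  · rintro ⟨hy, hfr⟩
    have hyr : ‖y - p‖ = r := by rwa [← dist_eq_norm]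
    have hdy : infDist y S = r := frontier_lt_subset_eq hcont continuous_const hfr
    have hy' : p + r • r⁻¹ • (y - p) = y := by
      rw [smul_inv_smul₀ hr.ne']
      abel
    refine ⟨r⁻¹ • (y - p), ⟨?_, ?_⟩, hy'⟩
    · rw [norm_smul, hyr, norm_inv, Real.norm_eq_abs, abs_of_pos hr, inv_mul_cancel₀ hr.ne']
    · rw [hy', hdy]
  · rintro ⟨n, ⟨hn, hd⟩, rfl⟩
    refine ⟨by simp [norm_smul, hn, abs_of_pos hr], ?_⟩
    rw [(isOpen_lt hcont continuous_const).frontier_eq]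
    refine ⟨?_, by simp [hd]⟩
    have hlim : Tendsto (fun t : ℝ => p + t • n) (𝓝[<] r) (𝓝 (p + r • n)) :=
      (Continuous.tendsto (by fun_prop) r).mono_left nhdsWithin_le_nhds
    refine mem_closure_of_tendsto hlim ?_
    filter_upwards [self_mem_nhdsWithin, mem_nhdsWithin_of_mem_nhds (lt_mem_nhds hr)]
      with t ht ht0
    have := infDist_add_smul_of_le hp hn hd ht0.le (le_of_lt ht)
    exact this.trans_lt ht

/-- A unit vector of the plane can be completed to an orthonormal frame. -/
lemma exists_orthonormal_frame {n : E2} (hn : ‖n‖ = 1) :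
    ∃ e : E2, ‖e‖ = 1 ∧ ⟪n, e⟫ = 0 ∧ ∀ x : E2, x = ⟪x, n⟫ • n + ⟪x, e⟫ • e := by
  have hsq : n 0 ^ 2 + n 1 ^ 2 = 1 := by
    have := EuclideanSpace.real_norm_sq_eq n
    rw [hn, Fin.sum_univ_two] at this
    linarith
  refine ⟨!₂[-n 1, n 0], ?_, ?_, fun x => ?_⟩
  · rw [EuclideanSpace.norm_eq]
    simp [Fin.sum_univ_two, add_comm, hsq]
  · simp [PiLp.inner_apply, Fin.sum_univ_two]
    ring
  · ext i
    fin_cases i <;> simp [PiLp.inner_apply, Fin.sum_univ_two]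
    · linear_combination (-(x 0)) * hsq
    · linear_combination (-(x 1)) * hsq

/-- A closed set of unit vectors of the plane which spans a convex cone and is contained in no
open half-plane contains two antipodal vectors. -/
lemma exists_neg_mem_of_forall_exists_inner_nonneg {N : Set E2} (hcomp : IsCompact N)
    (hunit : ∀ n ∈ N, ‖n‖ = 1)
    (hcone : ∀ m ∈ N, ∀ n ∈ N, ∀ a b : ℝ, 0 ≤ a → 0 ≤ b → ‖a • m + b • n‖ = 1 →
      a • m + b • n ∈ N)
    (hdir : ∀ v : E2, ∃ n ∈ N, 0 ≤ ⟪n, v⟫) : ∃ n ∈ N, -n ∈ N := by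
  obtain ⟨n₀, hn₀, -⟩ := hdir 0
  obtain ⟨⟨m₁, m₂⟩, hm, hmin⟩ := (hcomp.prod hcomp).exists_isMinOn ⟨(n₀, n₀), hn₀, hn₀⟩
    (f := fun q : E2 × E2 => ⟪q.1, q.2⟫) (by fun_prop)
  obtain ⟨hm₁, hm₂⟩ : m₁ ∈ N ∧ m₂ ∈ N := hm
  have hmin' : ∀ x ∈ N, ∀ y ∈ N, ⟪m₁, m₂⟫ ≤ ⟪x, y⟫ := fun x hx y hy =>
    hmin (show (x, y) ∈ N ×ˢ N from ⟨hx, hy⟩)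
  obtain ⟨n, hn, hnv⟩ := hdir (-(m₁ + m₂))
  obtain ⟨c, hc⟩ : ∃ c, c = ⟪m₁, m₂⟫ := ⟨_, rfl⟩
  rw [← hc] at hmin'
  by_contra! hanti
  obtain ⟨e, he, hme, hdec⟩ := exists_orthonormal_frame (hunit m₁ hm₁)
  obtain ⟨s, hs⟩ : ∃ s, s = ⟪m₂, e⟫ := ⟨_, rfl⟩
  have hm₁m₁ : ⟪m₁, m₁⟫ = 1 := by rw [real_inner_self_eq_norm_sq, hunit m₁ hm₁, one_pow]
  have hee : ⟪e, e⟫ = 1 := by rw [real_inner_self_eq_norm_sq, he, one_pow]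
  have hem : ⟪e, m₁⟫ = 0 := by rw [real_inner_comm, hme]
  have hm₂e : m₂ = c • m₁ + s • e := by
    rw [hc, hs, real_inner_comm]
    exact hdec m₂
  have hcs : c ^ 2 + s ^ 2 = 1 := by
    have h : ⟪m₂, m₂⟫ = 1 := by rw [real_inner_self_eq_norm_sq, hunit m₂ hm₂, one_pow]
    rw [hm₂e] at h
    simp only [inner_add_left, inner_add_right, real_inner_smul_left, real_inner_smul_right,
      hm₁m₁, hee, hem, hme] at h
    linarith
  have hc0 : c ≤ 0 := by
    have h1 := hmin' n hn m₁ hm₁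
    have h2 := hmin' n hn m₂ hm₂
    rw [inner_neg_right, inner_add_right] at hnv
    linarith
  have hs0 : s ≠ 0 := by
    intro h0
    have hc1 : c = -1 := by
      rw [h0] at hcs
      nlinarith
    apply hanti m₁ hm₁
    rw [h0, hc1] at hm₂e
    simpa [hm₂e] using hm₂
  obtain ⟨α, β, hαβ⟩ : ∃ α β : ℝ, n = α • m₁ + β • m₂ := by
    refine ⟨⟪n, m₁⟫ - ⟪n, e⟫ / s * c, ⟪n, e⟫ / s, ?_⟩
    conv_lhs => rw [hdec n]
    rw [hm₂e, smul_add, smul_smul, smul_smul, div_mul_cancel₀ _ hs0]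
    module
  have hm₂m₂ : ⟪m₂, m₂⟫ = 1 := by rw [real_inner_self_eq_norm_sq, hunit m₂ hm₂, one_pow]
  have hn1 : ⟪n, m₁⟫ = α + c * β := by
    rw [hαβ, inner_add_left, real_inner_smul_left, real_inner_smul_left, hm₁m₁,
      real_inner_comm, ← hc]
    ring
  have hn2 : ⟪n, m₂⟫ = c * α + β := by
    rw [hαβ, inner_add_left, real_inner_smul_left, real_inner_smul_left, hm₂m₂, ← hc]
    ring
  have hnn : α * (α + c * β) + β * (c * α + β) = 1 := by
    have h : ⟪n, n⟫ = 1 := by rw [real_inner_self_eq_norm_sq, hunit n hn, one_pow]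
    nth_rw 2 [hαβ] at h
    rw [inner_add_right, real_inner_smul_right, real_inner_smul_right, hn1, hn2] at h
    exact h
  have hb1 := hmin' n hn m₁ hm₁
  have hb2 := hmin' n hn m₂ hm₂
  rw [inner_neg_right, inner_add_right] at hnv
  rw [hn1] at hb1 hnv
  rw [hn2] at hb2 hnv
  have hc1 : 0 < 1 + c := by nlinarith [sq_pos_of_ne_zero hs0]
  have hsum : α + β ≤ 0 := by
    by_contra! hcon
    nlinarith [mul_pos hcon hc1]
  have hnot : ¬ (α ≤ 0 ∧ β ≤ 0) := by
    rintro ⟨hα, hβ⟩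
    apply hanti n hn
    have hneg : -n = (-α) • m₁ + (-β) • m₂ := by
      rw [hαβ]
      module
    rw [hneg]
    refine hcone m₁ hm₁ m₂ hm₂ _ _ (by linarith) (by linarith) ?_
    rw [← hneg, norm_neg, hunit n hn]
  have hexcl : ∀ x y : ℝ, 0 < y → x + y ≤ 0 → c ≤ x + c * y →
      x * (x + c * y) + y * (c * x + y) = 1 → False := by
    intro x y hy hxy h1 h2
    have h3 : (x + c * y) ^ 2 ≤ c ^ 2 := by
      rw [← neg_sq c]
      have hcy : c * y ≤ 0 := mul_nonpos_of_nonpos_of_nonneg hc0 hy.le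
      exact sq_le_sq' (by linarith) (by linarith)
    have h4 : 1 ≤ y := by
      have h5 : (1 - c ^ 2) * (1 - y ^ 2) ≤ 0 := by nlinarith
      have h6 : 0 < 1 - c ^ 2 := by nlinarith [sq_pos_of_ne_zero hs0]
      by_contra! hcon
      nlinarith [mul_pos h6 (show 0 < 1 - y ^ 2 by nlinarith)]
    nlinarith
  rcases lt_or_ge 0 β with hβ | hβ
  · exact hexcl α β hβ hsum hb1 hnn
  · rcases lt_or_ge 0 α with hα | hα
    · exact hexcl β α hα (by linarith) (by linarith) (by linarith)
    · exact hnot ⟨hα, hβ⟩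

/-- A set of unit vectors which spans a convex cone and contains a line is a pair of antipodal
vectors, a semicircle or the whole circle. -/
lemma eq_pair_or_halfCircle_or_circle {N : Set E2}
    (hunit : ∀ n ∈ N, ‖n‖ = 1)
    (hcone : ∀ m ∈ N, ∀ n ∈ N, ∀ a b : ℝ, 0 ≤ a → 0 ≤ b → ‖a • m + b • n‖ = 1 →
      a • m + b • n ∈ N)
    {n : E2} (hn : n ∈ N) (hn' : -n ∈ N) :
    N = {n, -n} ∨
    (∃ e : E2, ‖e‖ = 1 ∧ ⟪n, e⟫ = 0 ∧
      N = (fun θ : ℝ => Real.cos θ • n + Real.sin θ • e) '' Icc 0 π) ∨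
    ∀ m : E2, ‖m‖ = 1 → m ∈ N := by
  have hsq : ∀ e : E2, ‖e‖ = 1 → ⟪n, e⟫ = 0 → ∀ a b : ℝ,
      ‖a • n + b • e‖ ^ 2 = a ^ 2 + b ^ 2 := by
    intro e he hne a b
    rw [norm_add_sq_real, real_inner_smul_left, real_inner_smul_right, hne, norm_smul, norm_smul,
      hunit n hn, he, Real.norm_eq_abs, Real.norm_eq_abs, mul_one, mul_one, sq_abs, sq_abs]
    ring
  -- a normal on one side of the line forces the whole side
  have hside : ∀ e : E2, ‖e‖ = 1 → ⟪n, e⟫ = 0 → (∀ x : E2, x = ⟪x, n⟫ • n + ⟪x, e⟫ • e) →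
      ∀ m ∈ N, 0 < ⟪m, e⟫ → ∀ x : E2, ‖x‖ = 1 → 0 ≤ ⟪x, e⟫ → x ∈ N := by
    intro e he hne hdec m hm hme x hx hxe
    obtain ⟨b, hb⟩ : ∃ b, b = ⟪x, e⟫ / ⟪m, e⟫ := ⟨_, rfl⟩
    obtain ⟨a, ha⟩ : ∃ a, a = ⟪x, n⟫ - b * ⟪m, n⟫ := ⟨_, rfl⟩
    have hb0 : 0 ≤ b := hb ▸ div_nonneg hxe hme.le
    have hbe : b * ⟪m, e⟫ = ⟪x, e⟫ := by rw [hb, div_mul_cancel₀ _ hme.ne']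
    have hxab : x = a • n + b • m := by
      conv_lhs => rw [hdec x]
      conv_rhs => rw [hdec m]
      rw [ha, ← hbe]
      module
    rcases le_total 0 a with ha0 | ha0
    · rw [hxab] at hx ⊢
      exact hcone n hn m hm a b ha0 hb0 hx
    · have hxab' : x = (-a) • (-n) + b • m := by rw [hxab, neg_smul_neg]
      rw [hxab'] at hx ⊢
      exact hcone (-n) hn' m hm (-a) b (by linarith) hb0 hx
  have harc : ∀ e : E2, ‖e‖ = 1 → ⟪n, e⟫ = 0 → (∀ x : E2, x = ⟪x, n⟫ • n + ⟪x, e⟫ • e) →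
      (∃ m ∈ N, 0 < ⟪m, e⟫) → (∀ m ∈ N, 0 ≤ ⟪m, e⟫) →
      N = (fun θ : ℝ => Real.cos θ • n + Real.sin θ • e) '' Icc 0 π := by
    rintro e he hne hdec ⟨m, hm, hme⟩ hge
    ext x
    constructor
    · intro hx
      have h1 : ⟪x, n⟫ ^ 2 + ⟪x, e⟫ ^ 2 = 1 := by
        rw [← hsq e he hne, ← hdec x, hunit x hx, one_pow]
      refine ⟨Real.arccos ⟪x, n⟫, ⟨Real.arccos_nonneg _, Real.arccos_le_pi _⟩, ?_⟩
      have h2 : Real.sin (Real.arccos ⟪x, n⟫) = ⟪x, e⟫ := by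
        rw [Real.sin_arccos, ← Real.sqrt_sq (hge x hx)]
        congr 1
        linarith
      show Real.cos _ • n + Real.sin _ • e = x
      rw [h2, Real.cos_arccos (by nlinarith) (by nlinarith), ← hdec x]
    · rintro ⟨θ, hθ, rfl⟩
      refine hside e he hne hdec m hm hme _ ?_ ?_
      · have := hsq e he hne (Real.cos θ) (Real.sin θ)
        rw [Real.cos_sq_add_sin_sq] at this
        exact (pow_eq_one_iff_of_nonneg (norm_nonneg _) two_ne_zero).1 this
      · simp only [inner_add_left, real_inner_smul_left, hne, real_inner_self_eq_norm_sq, he]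
        simpa using Real.sin_nonneg_of_mem_Icc hθ
  obtain ⟨e, he, hne, hdec⟩ := exists_orthonormal_frame (hunit n hn)
  have he' : ‖-e‖ = 1 := by rw [norm_neg, he]
  have hne' : ⟪n, -e⟫ = 0 := by rw [inner_neg_right, hne, neg_zero]
  have hdec' : ∀ x : E2, x = ⟪x, n⟫ • n + ⟪x, -e⟫ • (-e) := fun x => by
    rw [inner_neg_right, neg_smul_neg]
    exact hdec x
  by_cases hpos : ∃ m ∈ N, 0 < ⟪m, e⟫ <;> by_cases hneg : ∃ m ∈ N, 0 < ⟪m, -e⟫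
  · right; right
    intro x hx
    obtain ⟨m, hm, hme⟩ := hpos
    obtain ⟨m', hm', hme'⟩ := hneg
    rcases le_total 0 ⟪x, e⟫ with h | h
    · exact hside e he hne hdec m hm hme x hx h
    · exact hside (-e) he' hne' hdec' m' hm' hme' x hx (by rw [inner_neg_right]; linarith)
  · right; left
    push Not at hneg
    exact ⟨e, he, hne, harc e he hne hdec hpos fun m hm => by
      have := hneg m hm
      rw [inner_neg_right] at this
      linarith⟩
  · right; left
    push Not at hpos
    exact ⟨-e, he', hne', harc (-e) he' hne' hdec' hneg fun m hm => by
      have := hpos m hm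
      rw [inner_neg_right]
      linarith⟩
  · left
    push Not at hpos hneg
    ext x
    simp only [mem_insert_iff, mem_singleton_iff]
    constructor
    · intro hx
      have h0 : ⟪x, e⟫ = 0 := by
        have h1 := hpos x hx
        have h2 := hneg x hx
        rw [inner_neg_right] at h2
        linarith
      have h1 := hdec x
      have h2 := hsq e he hne ⟪x, n⟫ ⟪x, e⟫
      rw [← h1, hunit x hx, h0] at h2
      rw [h0, zero_smul, add_zero] at h1
      rcases sq_eq_one_iff.1 (show ⟪x, n⟫ ^ 2 = 1 by linarith) with h | h
      · left; rw [h1, h, one_smul]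
      · right; rw [h1, h, neg_one_smul]
    · rintro (rfl | rfl)
      · exact hn
      · exact hn'

/-- **Proposition.** Let `S ⊆ ℝ²` be nonempty, closed, connected, with empty interior,
and proximally `C¹` of radius `r_S > 0`; let `r ∈ (0, r_S)`, `p ∈ S`, and assume
`S ≠ {p}`. Then `C_r(p)` consists either of exactly two antipodal points of `∂B_r(p)`,
or of a closed semicircumference of `∂B_r(p)` (a closed arc of length exactly `πr`). -/
theorem stmt14 (S : Set E2) (rS : ℝ) (hrS : 0 < rS)
    (hne : S.Nonempty) (hcl : IsClosed S) (hconn : IsConnected S)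
    (hint : interior S = ∅)
    (hprox : ContDiffOn ℝ 1 (fun x => infDist x S)
      {x | 0 < infDist x S ∧ infDist x S < rS})
    (r : ℝ) (hr : r ∈ Set.Ioo 0 rS) (p : E2) (hp : p ∈ S) (hnotsing : S ≠ {p}) :
    (∃ a b : E2, a ≠ b ∧ a + b = p + p ∧ contactSet S r p = {a, b}) ∨
    IsClosedArc p r (contactSet S r p) (π * r) := by
  obtain ⟨hr0, hrR⟩ := hr
  have hopen : IsOpen {x : E2 | 0 < infDist x S ∧ infDist x S < rS} :=
    (isOpen_lt continuous_const (continuous_infDist_pt S)).inter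
      (isOpen_lt (continuous_infDist_pt S) continuous_const)
  have hd : ∀ x, 0 < infDist x S → infDist x S < rS →
      DifferentiableAt ℝ (fun x => infDist x S) x := fun x h0 h1 =>
    (hprox.differentiableOn one_ne_zero).differentiableAt (hopen.mem_nhds ⟨h0, h1⟩)
  have hunit : ∀ n ∈ unitNormals S r p, ‖n‖ = 1 := fun n hn => hn.1
  have hcone : ∀ m ∈ unitNormals S r p, ∀ n ∈ unitNormals S r p, ∀ a b : ℝ, 0 ≤ a → 0 ≤ b →
      ‖a • m + b • n‖ = 1 → a • m + b • n ∈ unitNormals S r p :=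
    fun m hm n hn a b ha hb hab =>
      smul_add_smul_mem_unitNormals hcl hd ⟨hr0, hrR⟩ hp hm hn ha hb hab
  obtain ⟨n, hn, hn'⟩ := exists_neg_mem_of_forall_exists_inner_nonneg
    (isCompact_unitNormals S r p) hunit hcone
    (exists_mem_unitNormals_inner_nonneg hcl hint hd ⟨hr0, hrR⟩ hp)
  rw [contactSet_eq_image_unitNormals hr0 hp]
  rcases eq_pair_or_halfCircle_or_circle hunit hcone hn hn' with h | ⟨e, he, hne, h⟩ | h
  · left
    refine ⟨p + r • n, p + r • (-n), ?_, ?_, by rw [h, image_pair]⟩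
    · intro heq
      have h1 : n = -n := smul_right_injective E2 hr0.ne' (add_left_cancel heq)
      have h2 : ⟪n, n⟫ = -⟪n, n⟫ := by
        nth_rw 1 [h1]
        exact inner_neg_left n n
      rw [real_inner_self_eq_norm_sq, hunit n hn] at h2
      norm_num at h2
    · rw [smul_neg]
      abel
  · right
    refine ⟨n, e, hunit n hn, he, hne, ?_⟩
    rw [h, image_image, mul_div_cancel_right₀ _ hr0.ne']
    simp only [smul_add, smul_smul, add_assoc]
  · exact absurd (eq_singleton_of_forall_mem_unitNormals hconn.isPreconnected hr0 hp h) hnotsing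
end
end

section
/- Let S ⊆ ℝ² satisfy (H1) and let r ∈ (0, r_S). Then for every p ∈ S the contact set C_r(p) is a nonempty closed subset of ∂B_r(p) containing at least two points, and for distinct p, q ∈ S one has C_r(p) ∩ C_r(q) = ∅. -/
open Metric Set Real

noncomputable section

section DistanceFunction

variable {E : Type*} [NormedAddCommGroup E] [NormedSpace ℝ E] [ProperSpace E]

/-- Moving away from a nearest point of `S`, a differentiable distance function grows at
every rate less than one. -/
theorem exists_unit_vector_infDist_growth {S : Set E} (hne : S.Nonempty) (hcl : IsClosed S)
    {z : E} (hz : 0 < infDist z S) (hd : DifferentiableAt ℝ (fun x => infDist x S) z)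
    {c : ℝ} (hc : c < 1) :
    ∃ g : E, ‖g‖ = 1 ∧
      ∀ᶠ h : ℝ in nhdsWithin 0 (Ioi 0), infDist z S + c * h < infDist (z + h • g) S := by
  obtain ⟨q, hq, hzq⟩ := hcl.exists_infDist_eq_dist hne z
  have hpos : 0 < ‖z - q‖ := by rw [← dist_eq_norm, ← hzq]; exact hz
  set g : E := ‖z - q‖⁻¹ • (z - q) with hg
  have hg1 : ‖g‖ = 1 := by
    rw [hg, norm_smul, norm_inv, norm_norm, inv_mul_cancel₀ hpos.ne']
  have hgq : z - q = ‖z - q‖ • g := by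
    rw [hg, smul_smul, mul_inv_cancel₀ hpos.ne', one_smul]
  set L := fderiv ℝ (fun x => infDist x S) z g
  have hderiv : HasDerivAt (fun h : ℝ => infDist (z + h • g) S) L 0 := by
    have h1 : HasDerivAt (fun h : ℝ => z + h • g) g 0 := by
      simpa using ((hasDerivAt_id (0 : ℝ)).smul_const g).const_add z
    have h2 : HasFDerivAt (fun x => infDist x S)
        (fderiv ℝ (fun x => infDist x S) z) (z + (0 : ℝ) • g) := by
      simpa using hd.hasFDerivAt
    exact h2.comp_hasDerivAt (0 : ℝ) h1
  have hslope := hasDerivAt_iff_tendsto_slope.1 hderiv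
  have hL : 1 ≤ L := by
    refine ge_of_tendsto (hslope.mono_left
      (nhdsWithin_mono (0 : ℝ) (s := Iio 0) (fun x hx => ne_of_lt hx))) ?_
    have hmem : Ioo (-‖z - q‖) 0 ∈ nhdsWithin (0 : ℝ) (Iio 0) :=
      Ioo_mem_nhdsLT (by linarith)
    filter_upwards [hmem] with h hh
    have hle : infDist (z + h • g) S ≤ infDist z S + h := by
      refine (infDist_le_dist_of_mem hq).trans ?_
      have : z + h • g - q = (‖z - q‖ + h) • g := by
        rw [add_smul, ← hgq]; abel
      rw [dist_eq_norm, this, norm_smul, hg1, hzq, dist_eq_norm, Real.norm_eq_abs,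
        abs_of_pos (by linarith [hh.1])]
      simp
    rw [slope_def_field, le_div_iff_of_neg (by linarith [hh.2])]
    simp only [zero_smul, add_zero]
    linarith
  refine ⟨g, hg1, ?_⟩
  have hev : ∀ᶠ h in nhdsWithin (0 : ℝ) (Ioi 0),
      c < slope (fun h : ℝ => infDist (z + h • g) S) 0 h :=
    (hslope.mono_left (nhdsWithin_mono (0 : ℝ) (fun x hx => ne_of_gt hx))).eventually
      (lt_mem_nhds (hc.trans_le hL))
  filter_upwards [hev, self_mem_nhdsWithin] with h hh hpos'
  rw [slope_def_field, lt_div_iff₀ (by simpa using hpos')] at hh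
  simp only [zero_smul, add_zero, sub_zero] at hh
  linarith

/-- If the distance function is differentiable on `{0 < d < R}`, then from any point of this
region one can reach the level `s < R` by moving along the smallest conceivable distance. -/
theorem exists_infDist_eq_of_differentiableAt {S : Set E} (hne : S.Nonempty)
    (hcl : IsClosed S) {R : ℝ}
    (hd : ∀ z, 0 < infDist z S → infDist z S < R →
      DifferentiableAt ℝ (fun x => infDist x S) z)
    {x : E} (hx : 0 < infDist x S) {s : ℝ} (hxs : infDist x S ≤ s) (hs : s < R) :
    ∃ y, infDist y S = s ∧ dist y x = s - infDist x S := by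
  set ρ := s - infDist x S with hρ
  have hρ0 : 0 ≤ ρ := by linarith
  have hcont : Continuous (fun z : E => infDist z S) := continuous_infDist_pt S
  have hcomp : IsCompact (closedBall x ρ) := isCompact_closedBall x ρ
  have hnonempty : (closedBall x ρ).Nonempty := ⟨x, mem_closedBall_self hρ0⟩
  have key : ∀ c : ℝ, 0 ≤ c → c < 1 → ∃ z ∈ closedBall x ρ, infDist x S + c * ρ ≤ infDist z S := by
    intro c hc0 hc1
    obtain ⟨z, hz, hmax⟩ := hcomp.exists_isMaxOn hnonempty
      (f := fun z => infDist z S - c * dist z x) (by fun_prop)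
    have hzx := hmax (mem_closedBall_self hρ0)
    simp only [mem_ofPred_eq, dist_self, mul_zero, sub_zero] at hzx
    rw [mem_closedBall] at hz
    rcases hz.eq_or_lt with heq | hlt
    · exact ⟨z, mem_closedBall.2 hz, by rw [heq] at hzx; linarith⟩
    exfalso
    have hdist : 0 ≤ c * dist z x := mul_nonneg hc0 dist_nonneg
    have hlip : infDist z S ≤ infDist x S + dist z x := infDist_le_infDist_add_dist
    obtain ⟨g, hg, hev⟩ := exists_unit_vector_infDist_growth hne hcl
      (show 0 < infDist z S by linarith) (hd z (by linarith) (by linarith)) hc1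
    have hmem : Ioo (0 : ℝ) (ρ - dist z x) ∈ nhdsWithin (0 : ℝ) (Ioi 0) :=
      Ioo_mem_nhdsGT (by linarith)
    obtain ⟨h, hgrow, hh⟩ := (hev.and hmem).exists
    have hstep : dist (z + h • g) x ≤ dist z x + h := by
      refine (dist_triangle _ z x).trans ?_
      have : dist (z + h • g) z = h := by
        rw [dist_eq_norm, add_sub_cancel_left, norm_smul, hg, Real.norm_eq_abs,
          abs_of_pos hh.1, mul_one]
      linarith
    have hle := hmax (show z + h • g ∈ closedBall x ρ from
      mem_closedBall.2 (by linarith [hh.2]))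
    simp only [mem_ofPred_eq] at hle
    nlinarith [mul_le_mul_of_nonneg_left hstep hc0]
  obtain ⟨y, hy, hmax⟩ := hcomp.exists_isMaxOn hnonempty hcont.continuousOn
  have hge : s ≤ infDist y S := by
    have hlim : Filter.Tendsto (fun c : ℝ => infDist x S + c * ρ) (nhdsWithin 1 (Iio 1))
        (nhds (infDist x S + 1 * ρ)) :=
      (Continuous.tendsto (by fun_prop) 1).mono_left nhdsWithin_le_nhds
    have := le_of_tendsto hlim (b := infDist y S) (by
      filter_upwards [Ioo_mem_nhdsLT (show (0 : ℝ) < 1 by norm_num)] with c hc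
      obtain ⟨z, hz, hcz⟩ := key c hc.1.le hc.2
      exact hcz.trans (hmax hz))
    linarith
  rw [mem_closedBall] at hy
  have hlip : infDist y S ≤ infDist x S + dist y x := infDist_le_infDist_add_dist
  exact ⟨y, by linarith, by linarith⟩

end DistanceFunction

/-- A point at distance less than `R` from `S` has at most one nearest point in `S`, when the
distance function is differentiable on `{0 < d < R}`. -/
theorem eq_of_dist_eq_infDist {E : Type*} [NormedAddCommGroup E] [InnerProductSpace ℝ E]
    [ProperSpace E] {S : Set E} (hcl : IsClosed S) {R : ℝ}
    (hd : ∀ z, 0 < infDist z S → infDist z S < R →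
      DifferentiableAt ℝ (fun x => infDist x S) z)
    {y p q : E} (hy : 0 < infDist y S) (hyR : infDist y S < R) (hp : p ∈ S) (hq : q ∈ S)
    (hyp : dist y p = infDist y S) (hyq : dist y q = infDist y S) : p = q := by
  obtain ⟨s, hys, hsR⟩ := exists_between hyR
  obtain ⟨w, hws, hwy⟩ := exists_infDist_eq_of_differentiableAt ⟨p, hp⟩ hcl hd hy hys.le hsR
  have hinner : ∀ a ∈ S, dist y a = infDist y S →
      (s - infDist y S) * infDist y S ≤ inner ℝ (w - y) (y - a) := by
    intro a ha hya
    have h1 : s ≤ ‖(w - y) + (y - a)‖ := by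
      rw [sub_add_sub_cancel, ← dist_eq_norm, ← hws]
      exact infDist_le_dist_of_mem ha
    have h2 := norm_add_sq_real (w - y) (y - a)
    rw [← dist_eq_norm w, ← dist_eq_norm y, hwy, hya] at h2
    nlinarith
  have h1 := add_le_add (hinner p hp hyp) (hinner q hq hyq)
  rw [← inner_add_right] at h1
  have h2 := real_inner_le_norm (w - y) ((y - p) + (y - q))
  rw [← dist_eq_norm w, hwy] at h2
  have h3 : 2 * infDist y S ≤ ‖(y - p) + (y - q)‖ := by
    have : 0 < s - infDist y S := by linarith
    refine le_of_mul_le_mul_left ?_ this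
    linarith
  have h4 := parallelogram_law_with_norm ℝ (y - p) (y - q)
  rw [← dist_eq_norm y, ← dist_eq_norm y, hyp, hyq] at h4
  have h5 : ‖(y - p) - (y - q)‖ = 0 := by nlinarith [norm_nonneg ((y - p) - (y - q))]
  rw [norm_eq_zero, sub_sub_sub_cancel_left, sub_eq_zero] at h5
  exact h5.symm

/-- If `S` has empty interior and its distance function is differentiable on `{0 < d < R}`,
then for each unit vector `v` some point other than `p + r • v` touches `S` at `p` from
distance `r`. -/
theorem exists_infDist_eq_dist_eq_ne {E : Type*} [NormedAddCommGroup E] [InnerProductSpace ℝ E]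
    [ProperSpace E] {S : Set E} (hcl : IsClosed S) (hint : interior S = ∅) {R : ℝ}
    (hd : ∀ z, 0 < infDist z S → infDist z S < R →
      DifferentiableAt ℝ (fun x => infDist x S) z)
    {r : ℝ} (hr : 0 < r) (hrR : r < R) {p : E} (hp : p ∈ S) {v : E} (hv : ‖v‖ = 1) :
    ∃ y, infDist y S = r ∧ dist y p = r ∧ y ≠ p + r • v := by
  have happrox : ∀ n : ℕ, ∃ x y : E, dist x (p - (r / (n + 2)) • v) < r / (n + 2) / 4 ∧
      infDist y S = r ∧ dist y x = r - infDist x S := by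
    intro n
    have ht : 0 < r / ((n : ℝ) + 2) := by positivity
    have ht2 : r / ((n : ℝ) + 2) ≤ r / 2 :=
      div_le_div_of_nonneg_left hr.le (by norm_num) (by linarith [n.cast_nonneg (α := ℝ)])
    set t := r / ((n : ℝ) + 2)
    have hnot : ¬ ball (p - t • v) (t / 4) ⊆ S := by
      intro hsub
      have := interior_maximal hsub isOpen_ball (mem_ball_self (by positivity))
      simp [hint] at this
    obtain ⟨x, hxb, hxS⟩ := not_subset.1 hnot
    rw [mem_ball] at hxb
    have hx0 : 0 < infDist x S := (hcl.notMem_iff_infDist_pos ⟨p, hp⟩).1 hxS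
    have hxr : infDist x S ≤ r := by
      refine (infDist_le_dist_of_mem hp).trans ((dist_triangle _ (p - t • v) _).trans ?_)
      have : dist (p - t • v) p = t := by
        rw [dist_eq_norm, sub_sub_cancel_left, norm_neg, norm_smul, hv, mul_one,
          Real.norm_eq_abs, abs_of_pos ht]
      linarith
    obtain ⟨y, hy, hyx⟩ := exists_infDist_eq_of_differentiableAt ⟨p, hp⟩ hcl hd hx0 hxr hrR
    exact ⟨x, y, hxb, hy, hyx⟩
  choose x y hx hy hyx using happrox
  have ht : Filter.Tendsto (fun n : ℕ => r / ((n : ℝ) + 2)) Filter.atTop (nhds 0) :=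
    Filter.Tendsto.div_atTop tendsto_const_nhds
      (Filter.tendsto_atTop_add_const_right _ _ tendsto_natCast_atTop_atTop)
  have hxp : Filter.Tendsto x Filter.atTop (nhds p) := by
    have h1 : Filter.Tendsto (fun n : ℕ => p - (r / ((n : ℝ) + 2)) • v) Filter.atTop
        (nhds p) := by
      simpa using tendsto_const_nhds.sub (ht.smul_const v)
    have h2 : Filter.Tendsto (fun n : ℕ => dist (p - (r / ((n : ℝ) + 2)) • v) (x n))
        Filter.atTop (nhds 0) := by
      refine squeeze_zero (fun _ => dist_nonneg) (fun n => ?_) (by simpa using ht.div_const 4)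
      rw [dist_comm]; exact (hx n).le
    exact (tendsto_iff_of_dist h2).1 h1
  have hbdd : ∀ n, y n ∈ closedBall p (3 * r) := by
    intro n
    have h1 : dist (p - (r / ((n : ℝ) + 2)) • v) p = r / ((n : ℝ) + 2) := by
      rw [dist_eq_norm, sub_sub_cancel_left, norm_neg, norm_smul, hv, mul_one,
        Real.norm_eq_abs, abs_of_pos (by positivity)]
    have h2 : r / ((n : ℝ) + 2) ≤ r / 2 :=
      div_le_div_of_nonneg_left hr.le (by norm_num) (by linarith [n.cast_nonneg (α := ℝ)])
    have h3 := dist_triangle4 (y n) (x n) (p - (r / ((n : ℝ) + 2)) • v) p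
    have h4 : 0 ≤ infDist (x n) S := infDist_nonneg
    rw [mem_closedBall]
    linarith [hx n, hyx n]
  obtain ⟨z, -, φ, hφ, hlim⟩ := (isCompact_closedBall p (3 * r)).tendsto_subseq hbdd
  have hxφ := hxp.comp hφ.tendsto_atTop
  have hcont : Continuous (fun z : E => infDist z S) := continuous_infDist_pt S
  have hzr : infDist z S = r :=
    tendsto_nhds_unique ((hcont.tendsto z).comp hlim)
      (tendsto_const_nhds.congr fun n => (hy (φ n)).symm)
  have hzp : dist z p = r := by
    refine tendsto_nhds_unique (hlim.dist hxφ) ?_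
    have h1 : Filter.Tendsto (fun n => r - infDist (x (φ n)) S) Filter.atTop
        (nhds (r - infDist p S)) := tendsto_const_nhds.sub ((hcont.tendsto p).comp hxφ)
    rw [infDist_zero_of_mem hp, sub_zero] at h1
    exact h1.congr fun n => (hyx (φ n)).symm
  refine ⟨z, hzr, hzp, ?_⟩
  rintro rfl
  have hdir : Filter.Tendsto (fun n => dist (y (φ n) - x (φ n)) (r • v)) Filter.atTop
      (nhds 0) := by
    have := (hlim.sub hxφ).dist (tendsto_const_nhds (x := r • v))
    simpa using this
  obtain ⟨n, hn1, hn2⟩ := ((hdir.eventually (gt_mem_nhds (show 0 < r / 8 by positivity))).and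
    ((ht.comp hφ.tendsto_atTop).eventually (gt_mem_nhds (show 0 < r / 8 by positivity)))).exists
  have hxn := hx (φ n)
  have htpos : 0 < r / ((φ n : ℝ) + 2) := by positivity
  simp only [Function.comp_apply] at hn2
  set t := r / ((φ n : ℝ) + 2)
  set a := y (φ n) - x (φ n) with ha
  set e := x (φ n) - (p - t • v) with he
  have he' : ‖e‖ < t / 4 := by rw [he, ← dist_eq_norm]; exact hxn
  have har : ‖a‖ ≤ r := by
    rw [ha, ← dist_eq_norm, hyx]
    linarith [infDist_nonneg (x := x (φ n)) (s := S)]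
  have hyp : r ≤ ‖a + (e - t • v)‖ := by
    have : a + (e - t • v) = y (φ n) - p := by rw [ha, he]; abel
    rw [this, ← dist_eq_norm, ← hy (φ n)]
    exact infDist_le_dist_of_mem hp
  have hexp := norm_add_sq_real a (e - t • v)
  have hav : r * (7 / 8) ≤ inner ℝ a v := by
    have h1 := real_inner_le_norm (r • v - a) v
    rw [inner_sub_left, real_inner_smul_left, real_inner_self_eq_norm_sq, hv,
      ← dist_eq_norm, dist_comm] at h1
    linarith
  have hae : inner ℝ a e ≤ r * (t / 4) :=
    (real_inner_le_norm a e).trans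
      (mul_le_mul har he'.le (norm_nonneg _) hr.le)
  have hnorm : ‖e - t • v‖ ≤ 5 / 4 * t := by
    refine (norm_sub_le _ _).trans ?_
    rw [norm_smul, hv, Real.norm_eq_abs, abs_of_pos htpos]
    linarith
  rw [inner_sub_right, real_inner_smul_right] at hexp
  have h1 : r ^ 2 ≤ ‖a + (e - t • v)‖ ^ 2 := pow_le_pow_left₀ hr.le hyp 2
  have h2 : ‖a‖ ^ 2 ≤ r ^ 2 := pow_le_pow_left₀ (norm_nonneg _) har 2
  have h3 : ‖e - t • v‖ ^ 2 ≤ (5 / 4 * t) ^ 2 := pow_le_pow_left₀ (norm_nonneg _) hnorm 2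
  have h4 := mul_le_mul_of_nonneg_left hav htpos.le
  have h5 := mul_lt_mul_of_pos_left hn2 htpos
  nlinarith [mul_pos hr htpos]

theorem infDist_eq_of_mem_contactSet {S : Set E2} {r : ℝ} {p y : E2}
    (hy : y ∈ contactSet S r p) : infDist y S = r :=
  frontier_lt_subset_eq (continuous_infDist_pt S) continuous_const hy.2

theorem mem_contactSet_of_infDist_eq {S : Set E2} {r : ℝ} (hr : 0 < r) {p y : E2} (hp : p ∈ S)
    (hy : infDist y S = r) (hyp : dist y p = r) : y ∈ contactSet S r p := by
  refine ⟨hyp, ?_⟩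
  have hopen : IsOpen {x : E2 | infDist x S < r} :=
    isOpen_lt (continuous_infDist_pt S) continuous_const
  rw [hopen.frontier_eq]
  refine ⟨?_, fun h => (ne_of_lt h) hy⟩
  have hsub : ball p r ⊆ {x : E2 | infDist x S < r} := fun x hx =>
    (infDist_le_dist_of_mem hp).trans_lt hx
  refine closure_mono hsub ?_
  rw [closure_ball p hr.ne']
  exact hyp.le

/-- **Remark.** Let `S ⊆ ℝ²` be nonempty, closed, connected, with empty interior, and
proximally `C¹` of radius `r_S > 0`, and let `r ∈ (0, r_S)`. Then for every `p ∈ S` the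
contact set `C_r(p)` is a nonempty closed subset of `∂B_r(p)` containing at least two
points, and for distinct `p, q ∈ S` the contact sets `C_r(p)` and `C_r(q)` are
disjoint. -/
theorem stmt15 (S : Set E2) (rS : ℝ) (hrS : 0 < rS)
    (hne : S.Nonempty) (hcl : IsClosed S) (hconn : IsConnected S)
    (hint : interior S = ∅)
    (hprox : ContDiffOn ℝ 1 (fun x => infDist x S)
      {x | 0 < infDist x S ∧ infDist x S < rS})
    (r : ℝ) (hr : r ∈ Set.Ioo 0 rS) :
    (∀ p ∈ S, (contactSet S r p).Nonempty ∧ IsClosed (contactSet S r p) ∧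
      contactSet S r p ⊆ Metric.sphere p r ∧
      ∃ a ∈ contactSet S r p, ∃ b ∈ contactSet S r p, a ≠ b) ∧
    ∀ p ∈ S, ∀ q ∈ S, p ≠ q → contactSet S r p ∩ contactSet S r q = ∅ := by
  have hd : ∀ z, 0 < infDist z S → infDist z S < rS →
      DifferentiableAt ℝ (fun x => infDist x S) z := by
    intro z hz0 hz1
    have hopen : IsOpen {x : E2 | 0 < infDist x S ∧ infDist x S < rS} :=
      (isOpen_lt continuous_const (continuous_infDist_pt S)).inter
        (isOpen_lt (continuous_infDist_pt S) continuous_const)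
    exact (hprox.differentiableOn one_ne_zero).differentiableAt (hopen.mem_nhds ⟨hz0, hz1⟩)
  obtain ⟨hr0, hrR⟩ := hr
  refine ⟨fun p hp => ?_, fun p hp q hq hpq => ?_⟩
  · obtain ⟨v, hv⟩ := exists_norm_eq E2 zero_le_one
    obtain ⟨a, har, hap, -⟩ := exists_infDist_eq_dist_eq_ne hcl hint hd hr0 hrR hp hv
    have hnorm : ‖r⁻¹ • (a - p)‖ = 1 := by
      rw [norm_smul, ← dist_eq_norm, hap, Real.norm_eq_abs, abs_of_pos (inv_pos.2 hr0),
        inv_mul_cancel₀ hr0.ne']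
    obtain ⟨b, hbr, hbp, hba⟩ := exists_infDist_eq_dist_eq_ne hcl hint hd hr0 hrR hp hnorm
    rw [smul_smul, mul_inv_cancel₀ hr0.ne', one_smul, add_sub_cancel] at hba
    have ha := mem_contactSet_of_infDist_eq hr0 hp har hap
    have hb := mem_contactSet_of_infDist_eq hr0 hp hbr hbp
    exact ⟨⟨a, ha⟩, isClosed_sphere.inter isClosed_frontier, inter_subset_left,
      a, ha, b, hb, hba.symm⟩
  · refine eq_empty_of_forall_notMem fun y hy => hpq ?_
    have hyr := infDist_eq_of_mem_contactSet hy.1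
    refine eq_of_dist_eq_infDist hcl hd (hyr ▸ hr0) (hyr ▸ hrR) hp hq ?_ ?_
    · rw [hyr]; exact hy.1.1
    · rw [hyr]; exact hy.2.1
end
end

section
/- Let S ⊆ ℝ² satisfy (H1), assume S is not a singleton, fix r ∈ (0, r_S), and let S* := {p ∈ S : C_r(p) is a closed semicircumference of ∂B_r(p)}. Then S is a 1-dimensional Lipschitz manifold whose manifold boundary is exactly the (possibly empty) set S*: near each point p ∈ S, the set S coincides, in suitable orthonormal coordinates, with the graph of a Lipschitz function defined on an open interval if p ∈ S \ S*, and on a half-open interval with endpoint corresponding to p if p ∈ S*. -/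
open Metric Set Real
open scoped RealInnerProductSpace

noncomputable section

/-- The point of the Euclidean plane with coordinates `(a, b)`. -/
def pt (a b : ℝ) : E2 := (EuclideanSpace.equiv (Fin 2) ℝ).symm ![a, b]

/-- `S*`, the set of points of `S` whose contact set is a closed semicircumference. -/
def semiSet (S : Set E2) (r : ℝ) : Set E2 :=
  {p ∈ S | IsClosedArc p r (contactSet S r p) (π * r)}

section General

variable {E : Type*} [NormedAddCommGroup E] [InnerProductSpace ℝ E]

/-- The closed cone of vectors `w` such that, for `w ≠ 0`, the ball of radius `R` touching `p` in
the direction `w` does not meet `S` in its interior. -/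
def proxNormals (S : Set E) (R : ℝ) (p : E) : Set E :=
  {w | ∀ q ∈ S, 2 * R * ⟪q - p, w⟫ ≤ ‖w‖ * ‖q - p‖ ^ 2}

theorem isClosed_proxNormals_graph (S : Set E) (R : ℝ) :
    IsClosed {z : E × E | z.2 ∈ proxNormals S R z.1} := by
  have h : {z : E × E | z.2 ∈ proxNormals S R z.1} =
      ⋂ q ∈ S, {z : E × E | 2 * R * ⟪q - z.1, z.2⟫ ≤ ‖z.2‖ * ‖q - z.1‖ ^ 2} := by
    ext z; simp [proxNormals]
  rw [h]
  exact isClosed_biInter fun q _ => isClosed_le (by fun_prop) (by fun_prop)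

theorem isClosed_proxNormals (S : Set E) (R : ℝ) (p : E) : IsClosed (proxNormals S R p) :=
  (isClosed_proxNormals_graph S R).preimage (by fun_prop : Continuous fun w : E => (p, w))

theorem zero_mem_proxNormals (S : Set E) (R : ℝ) (p : E) : (0 : E) ∈ proxNormals S R p := by
  simp [proxNormals]

/-- Touching balls of radius `s` described through the distance function. -/
theorem infDist_add_smul_eq_iff {S : Set E} {p w : E} {s : ℝ} (hp : p ∈ S) (hw : ‖w‖ = 1)
    (hs : 0 ≤ s) :
    infDist (p + s • w) S = s ↔ ∀ q ∈ S, 2 * s * ⟪q - p, w⟫ ≤ ‖q - p‖ ^ 2 := by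
  have key : ∀ q, s ≤ dist (p + s • w) q ↔ 2 * s * ⟪q - p, w⟫ ≤ ‖q - p‖ ^ 2 := by
    intro q
    have h1 : ‖p + s • w - q‖ ^ 2 = ‖q - p‖ ^ 2 - 2 * s * ⟪q - p, w⟫ + s ^ 2 := by
      rw [show p + s • w - q = s • w - (q - p) by abel, norm_sub_sq_real, norm_smul, hw,
        inner_smul_left, real_inner_comm]
      simp; ring
    rw [dist_eq_norm, ← pow_le_pow_iff_left₀ hs (norm_nonneg _) two_ne_zero, h1]
    constructor <;> intro h <;> linarith
  have hle : infDist (p + s • w) S ≤ s := by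
    refine (infDist_le_dist_of_mem hp).trans ?_
    simp [norm_smul, hw, abs_of_nonneg hs]
  constructor
  · intro h q hq
    exact (key q).1 (h.symm.le.trans (infDist_le_dist_of_mem hq))
  · intro h
    refine le_antisymm hle ?_
    exact (le_infDist ⟨p, hp⟩).2 fun q hq => (key q).2 (h q hq)

variable [ProperSpace E]

/-- Where the distance function is differentiable near a point, segments of steepest descent can
be prolonged beyond that point. -/
theorem infDist_extend_step {S : Set E} {R : ℝ} (hcl : IsClosed S)
    (hdiff : ∀ x, 0 < infDist x S → infDist x S < R → DifferentiableAt ℝ (fun x => infDist x S) x)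
    {p n : E} {t ε : ℝ} (hp : p ∈ S) (hn : ‖n‖ = 1) (ht : 0 < t) (hε : 0 < ε) (hεt : ε < t)
    (htR : t + ε < R) (h : infDist (p + t • n) S = t) :
    infDist (p + (t + ε) • n) S = t + ε := by
  set x := p + t • n with hx
  obtain ⟨y, hy, hmax⟩ := (isCompact_closedBall x ε).exists_isMaxOn
    ⟨x, mem_closedBall_self hε.le⟩ (continuous_infDist_pt S).continuousOn
  have hxy : t ≤ infDist y S := h ▸ hmax (mem_closedBall_self hε.le)
  have hyx : ‖y - x‖ ≤ ε := by simpa [dist_eq_norm] using hy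
  have hylt : infDist y S ≤ t + ε := by
    have := infDist_le_infDist_add_dist (s := S) (x := y) (y := x)
    rw [h, dist_eq_norm] at this
    linarith
  obtain ⟨q, hq, hyq⟩ := hcl.exists_infDist_eq_dist ⟨p, hp⟩ y
  set d := infDist y S with hd
  have hd0 : 0 < d := by linarith
  have hyq' : ‖y - q‖ = d := by rw [hyq, dist_eq_norm]
  obtain ⟨m, hm⟩ : ∃ m, m = d⁻¹ • (y - q) := ⟨_, rfl⟩
  have hmn : ‖m‖ = 1 := by
    rw [hm, norm_smul, hyq', norm_inv, Real.norm_of_nonneg hd0.le, inv_mul_cancel₀ hd0.ne']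
  have hydm : y = q + d • m := by rw [hm, smul_inv_smul₀ hd0.ne']; abel
  have hD := (hdiff y hd0 (by linarith)).hasFDerivAt
  set D := fderiv ℝ (fun x => infDist x S) y with hDdef
  have hDn : ∀ w, D w ≤ ‖w‖ := by
    intro w
    have h1 : ‖D‖ ≤ (1 : NNReal) := norm_fderiv_le_of_lipschitz ℝ (lipschitz_infDist_pt S)
    have h2 := (le_abs_self _).trans (D.le_of_opNorm_le h1 w)
    simpa using h2
  have hDm : 1 ≤ D m := by
    have hφ : HasDerivAt (fun s : ℝ => infDist (y - s • m) S + s) (D (-m) + 1) 0 := by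
      have h1 : HasDerivAt (fun s : ℝ => y - s • m) (-m) 0 := by
        simpa using ((hasDerivAt_id (0 : ℝ)).smul_const m).const_sub y
      refine HasDerivAt.add ?_ (hasDerivAt_id 0)
      have h2 : HasFDerivAt (fun x => infDist x S) D (y - (0 : ℝ) • m) := by simpa using hD
      exact h2.comp_hasDerivAt (0 : ℝ) h1
    have hmx : IsMaxOn (fun s : ℝ => infDist (y - s • m) S + s) (Icc 0 d) 0 := by
      intro s hs
      have h1 : infDist (y - s • m) S ≤ dist (y - s • m) q := infDist_le_dist_of_mem hq
      have h2 : y - s • m - q = (d - s) • m := by rw [hydm, sub_smul]; abel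
      rw [dist_eq_norm, h2, norm_smul, hmn, Real.norm_of_nonneg (by linarith [hs.2])] at h1
      simp only [mem_ofPred_eq, zero_smul, sub_zero, add_zero]
      linarith
    have h3 := hmx.localize.hasFDerivWithinAt_nonpos hφ.hasFDerivAt.hasFDerivWithinAt
      (sub_mem_posTangentConeAt_of_segment_subset (y := d)
        ((convex_Icc 0 d).segment_subset (by simp [hd0.le]) (by simp [hd0.le])))
    simp only [sub_zero, map_neg] at h3
    have h4 : d * (- D m + 1) ≤ 0 := by simpa using h3
    nlinarith
  have hDx : D (x + ε • m - y) ≤ 0 := by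
    refine IsLocalMaxOn.hasFDerivWithinAt_nonpos (s := closedBall x ε) (hmax.localize)
      hD.hasFDerivWithinAt (sub_mem_posTangentConeAt_of_segment_subset ?_)
    refine (convex_closedBall x ε).segment_subset hy ?_
    simp [norm_smul, hmn, abs_of_pos hε]
  have hyxm : y - x = ε • m := by
    have h1 : ε ≤ D (y - x) := by
      have : x + ε • m - y = ε • m - (y - x) := by abel
      rw [this, map_sub, map_smul, smul_eq_mul] at hDx
      nlinarith
    have h2 : 2 * ε ≤ ‖(y - x) + ε • m‖ := by
      refine le_trans ?_ (hDn _)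
      rw [map_add, map_smul, smul_eq_mul]
      nlinarith
    have h3 := parallelogram_law_with_norm ℝ (y - x) (ε • m)
    have h4 : ‖ε • m‖ = ε := by simp [norm_smul, hmn, abs_of_pos hε]
    rw [h4] at h3
    have h5 : ‖y - x - ε • m‖ * ‖y - x - ε • m‖ ≤ 0 := by nlinarith [norm_nonneg (y - x)]
    have h6 : ‖y - x - ε • m‖ = 0 := by nlinarith [norm_nonneg (y - x - ε • m)]
    exact sub_eq_zero.1 (norm_eq_zero.1 h6)
  have hdt : t ≤ d - ε := by
    have h1 : x - q = (d - ε) • m := by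
      rw [sub_smul, ← hyxm, hydm]; abel
    have h2 : t ≤ dist x q := h ▸ infDist_le_dist_of_mem hq
    rw [dist_eq_norm, h1, norm_smul, hmn, Real.norm_of_nonneg (by linarith), mul_one] at h2
    exact h2
  have hyn : y - x = ε • n := by
    have h1 : t + ε ≤ ‖(y - x) + t • n‖ := by
      have : (y - x) + t • n = y - p := by rw [hx]; abel
      rw [this, ← dist_eq_norm]
      have := infDist_le_dist_of_mem (x := y) hp
      linarith
    have htn : ‖t • n‖ = t := by simp [norm_smul, hn, abs_of_pos ht]
    have hin : t * ε ≤ t * ⟪y - x, n⟫ := by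
      have h2 := norm_add_sq_real (y - x) (t • n)
      rw [htn, inner_smul_right] at h2
      nlinarith [norm_nonneg (y - x)]
    have hin' : ε ≤ ⟪y - x, n⟫ := le_of_mul_le_mul_left hin ht
    have h3 := norm_sub_sq_real (y - x) (ε • n)
    rw [inner_smul_right, norm_smul, hn, Real.norm_of_nonneg hε.le] at h3
    have h6 : ‖y - x - ε • n‖ ^ 2 ≤ 0 := by nlinarith [norm_nonneg (y - x)]
    exact sub_eq_zero.1 (norm_eq_zero.1 (by nlinarith [norm_nonneg (y - x - ε • n)]))
  have hfin : p + (t + ε) • n = y := by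
    rw [add_smul, ← hyn, hx]; abel
  rw [hfin]
  linarith

theorem infDist_extend {S : Set E} {R : ℝ} (hcl : IsClosed S)
    (hdiff : ∀ x, 0 < infDist x S → infDist x S < R → DifferentiableAt ℝ (fun x => infDist x S) x)
    {p n : E} {t s : ℝ} (hp : p ∈ S) (hn : ‖n‖ = 1) (ht : 0 < t) (hts : t ≤ s) (hsR : s < R)
    (h : infDist (p + t • n) S = t) : infDist (p + s • n) S = s := by
  have hstep : ∀ k : ℕ, ∃ t', 0 < t' ∧ t' ≤ s ∧ min s ((3 / 2) ^ k * t) ≤ t' ∧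
      infDist (p + t' • n) S = t' := by
    intro k
    induction k with
    | zero => exact ⟨t, ht, hts, by simp, h⟩
    | succ k ih =>
      obtain ⟨t', h0, h1, h2, h3⟩ := ih
      rcases h1.eq_or_lt with rfl | hlt
      · exact ⟨t', h0, le_rfl, min_le_left _ _, h3⟩
      · have hle : (3 / 2) ^ k * t ≤ t' := by
          rcases min_le_iff.1 h2 with h | h
          · linarith
          · exact h
        have hε : 0 < min (s - t') (t' / 2) := lt_min (by linarith) (by linarith)
        refine ⟨t' + min (s - t') (t' / 2), by linarith, ?_, ?_,
          infDist_extend_step hcl hdiff hp hn h0 hε ?_ ?_ h3⟩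
        · linarith [min_le_left (s - t') (t' / 2)]
        · rcases min_choice (s - t') (t' / 2) with h | h <;> rw [h]
          · exact (min_le_left _ _).trans (by linarith)
          · refine (min_le_right _ _).trans ?_
            rw [pow_succ]; linarith
        · linarith [min_le_right (s - t') (t' / 2)]
        · linarith [min_le_left (s - t') (t' / 2)]
  obtain ⟨k, hk⟩ := pow_unbounded_of_one_lt (s / t) (by norm_num : (1 : ℝ) < 3 / 2)
  obtain ⟨t', -, h1, h2, h3⟩ := hstep k
  rw [div_lt_iff₀ ht] at hk
  rw [min_eq_left hk.le] at h2
  rwa [le_antisymm h1 h2] at h3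

/-- Differentiability of the distance function in a tube gives a uniform radius to all
proximal normals. -/
theorem mem_proxNormals_of_inner_le {S : Set E} {R r : ℝ} (hcl : IsClosed S)
    (hdiff : ∀ x, 0 < infDist x S → infDist x S < R → DifferentiableAt ℝ (fun x => infDist x S) x)
    (hr : 0 < r) (hrR : r < R) {p w : E} {c : ℝ} (hp : p ∈ S)
    (h : ∀ q ∈ S, ⟪q - p, w⟫ ≤ c * ‖q - p‖ ^ 2) : w ∈ proxNormals S r p := by
  rcases eq_or_ne w 0 with rfl | hw
  · exact zero_mem_proxNormals S r p
  have hw' : 0 < ‖w‖ := norm_pos_iff.2 hw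
  obtain ⟨n, hn⟩ : ∃ n, n = ‖w‖⁻¹ • w := ⟨_, rfl⟩
  have hn1 : ‖n‖ = 1 := by rw [hn, norm_smul, norm_inv, norm_norm, inv_mul_cancel₀ hw'.ne']
  have hwn : w = ‖w‖ • n := by rw [hn, smul_inv_smul₀ hw'.ne']
  obtain ⟨t, ht0, htr, htc⟩ : ∃ t, 0 < t ∧ t ≤ r ∧ 2 * t * c ≤ ‖w‖ := by
    refine ⟨min r (‖w‖ / (2 * (|c| + 1))), by positivity, min_le_left _ _, ?_⟩
    have h1 : min r (‖w‖ / (2 * (|c| + 1))) * (2 * (|c| + 1)) ≤ ‖w‖ := by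
      rw [← le_div_iff₀ (by positivity)]; exact min_le_right _ _
    have h2 : 0 < min r (‖w‖ / (2 * (|c| + 1))) := by positivity
    nlinarith [le_abs_self c]
  have h1 : infDist (p + t • n) S = t := by
    rw [infDist_add_smul_eq_iff hp hn1 ht0.le]
    intro q hq
    have h2 := h q hq
    rw [hwn, inner_smul_right] at h2
    have h3 : ‖w‖ * (2 * t * ⟪q - p, n⟫) ≤ ‖w‖ * ‖q - p‖ ^ 2 := by
      nlinarith [sq_nonneg ‖q - p‖]
    exact le_of_mul_le_mul_left h3 hw'
  have h2 := infDist_extend hcl hdiff hp hn1 ht0 htr hrR h1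
  rw [infDist_add_smul_eq_iff hp hn1 hr.le] at h2
  intro q hq
  have h3 := h2 q hq
  have h4 : ⟪q - p, w⟫ = ‖w‖ * ⟪q - p, n⟫ := by
    conv_lhs => rw [hwn, inner_smul_right]
  rw [h4]
  nlinarith

end General

theorem isClosed_image_fst_of_norm_eq_one {X E : Type*} [TopologicalSpace X]
    [NormedAddCommGroup E] [ProperSpace E] {P : Set (X × E)} (hP : IsClosed P)
    (h1 : ∀ z ∈ P, ‖z.2‖ = 1) : IsClosed (Prod.fst '' P) := by
  have : CompactSpace (sphere (0 : E) 1) := isCompact_iff_compactSpace.1 (isCompact_sphere _ _)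
  have h2 : Prod.fst '' P =
      Prod.fst '' {z : X × sphere (0 : E) 1 | (z.1, (z.2 : E)) ∈ P} := by
    ext x
    constructor
    · rintro ⟨z, hz, rfl⟩
      exact ⟨(z.1, ⟨z.2, by simpa using h1 z hz⟩), hz, rfl⟩
    · rintro ⟨z, hz, rfl⟩
      exact ⟨_, hz, rfl⟩
  rw [h2]
  exact isClosedMap_fst_of_compactSpace _ (hP.preimage (by fun_prop))

section Reach

variable {E : Type*} [NormedAddCommGroup E] [InnerProductSpace ℝ E]

/-- Every proximal normal of `S`, of whatever radius, is a proximal normal of radius `R`. -/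
def UniformNormals (S : Set E) (R : ℝ) : Prop :=
  ∀ p ∈ S, ∀ (w : E) (c : ℝ), (∀ q ∈ S, ⟪q - p, w⟫ ≤ c * ‖q - p‖ ^ 2) → w ∈ proxNormals S R p

theorem smul_mem_proxNormals {S : Set E} {R : ℝ} {p w : E} {a : ℝ} (ha : 0 ≤ a)
    (hw : w ∈ proxNormals S R p) : a • w ∈ proxNormals S R p := by
  intro q hq
  rw [inner_smul_right, norm_smul, Real.norm_of_nonneg ha]
  nlinarith [mul_le_mul_of_nonneg_left (hw q hq) ha]

theorem add_mem_proxNormals {S : Set E} {R : ℝ} (hR : 0 < R) (h : UniformNormals S R) {p w z : E}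
    (hp : p ∈ S) (hw : w ∈ proxNormals S R p) (hz : z ∈ proxNormals S R p) :
    w + z ∈ proxNormals S R p := by
  refine h p hp _ ((‖w‖ + ‖z‖) / (2 * R)) fun q hq => ?_
  rw [inner_add_right, div_mul_eq_mul_div, le_div_iff₀ (by positivity)]
  linarith [hw q hq, hz q hq]

theorem convex_proxNormals {S : Set E} {R : ℝ} (hR : 0 < R) (h : UniformNormals S R) {p : E}
    (hp : p ∈ S) : Convex ℝ (proxNormals S R p) := by
  intro w hw z hz a b ha hb _
  exact add_mem_proxNormals hR h hp (smul_mem_proxNormals ha hw) (smul_mem_proxNormals hb hz)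

/-- A point of a connected set with more than one point does not have all vectors as normals. -/
theorem exists_notMem_proxNormals {S : Set E} {R : ℝ} (hR : 0 < R) (hconn : IsPreconnected S)
    {p q : E} (hp : p ∈ S) (hq : q ∈ S) (hqp : q ≠ p) : ∃ w, w ∉ proxNormals S R p := by
  by_contra! hc
  have h1 : ∀ q ∈ S, 0 < ‖q - p‖ → 2 * R ≤ ‖q - p‖ := by
    intro q hq h0
    have h2 := hc (q - p) q hq
    rw [real_inner_self_eq_norm_sq] at h2
    have h3 : ‖q - p‖ ^ 2 * (2 * R) ≤ ‖q - p‖ ^ 2 * ‖q - p‖ := by nlinarith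
    exact le_of_mul_le_mul_left h3 (by positivity)
  have h2 := h1 q hq (norm_pos_iff.2 (sub_ne_zero.2 hqp))
  obtain ⟨z, hz, hzR⟩ := hconn.intermediate_value hp hq
    (by fun_prop : ContinuousOn (fun z => ‖z - p‖) S) (show R ∈ Icc ‖p - p‖ ‖q - p‖ by
      constructor
      · simpa using hR.le
      · linarith)
  have h3 := h1 z hz (by simp only at hzR; linarith)
  simp only at hzR
  linarith

variable [ProperSpace E]

/-- A nearest point projection provides a proximal normal. -/
theorem exists_proxNormal_of_notMem {S : Set E} {R : ℝ} (hR : 0 < R) (hcl : IsClosed S)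
    (h : UniformNormals S R) {p x : E} (hp : p ∈ S) (hx : x ∉ S) :
    ∃ q ∈ S, ∃ n ∈ proxNormals S R q, ‖n‖ = 1 ∧ dist x q = infDist x S ∧
      ‖q - p‖ ≤ 2 * ‖x - p‖ ∧ infDist x S ≤ ⟪x - p, n⟫ + 2 * ‖x - p‖ ^ 2 / R := by
  obtain ⟨q, hq, hxq⟩ := hcl.exists_infDist_eq_dist ⟨p, hp⟩ x
  have hd : 0 < ‖x - q‖ := by
    rw [norm_pos_iff, sub_ne_zero]; rintro rfl; exact hx hq
  have hxp : ‖x - q‖ ≤ ‖x - p‖ := by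
    rw [← dist_eq_norm, ← dist_eq_norm, ← hxq]; exact infDist_le_dist_of_mem hp
  have hqp : ‖q - p‖ ≤ 2 * ‖x - p‖ := by
    have := norm_sub_le (x - p) (x - q)
    rw [show x - p - (x - q) = q - p by abel] at this
    linarith
  have hz : x - q ∈ proxNormals S R q := by
    refine h q hq _ (1 / 2) fun q' hq' => ?_
    have h1 : ‖x - q‖ ≤ ‖x - q'‖ := by
      rw [← dist_eq_norm, ← dist_eq_norm, ← hxq]; exact infDist_le_dist_of_mem hq'
    have h2 := norm_sub_sq_real (x - q) (q' - q)
    rw [show x - q - (q' - q) = x - q' by abel, real_inner_comm] at h2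
    nlinarith [norm_nonneg (x - q)]
  refine ⟨q, hq, ‖x - q‖⁻¹ • (x - q), smul_mem_proxNormals (by positivity) hz, ?_, hxq.symm, hqp,
    ?_⟩
  · rw [norm_smul, norm_inv, norm_norm, inv_mul_cancel₀ hd.ne']
  · have h1 := smul_mem_proxNormals (inv_nonneg.2 hd.le) hz p hp
    have h2 : ‖x - q‖ = ⟪x - q, ‖x - q‖⁻¹ • (x - q)⟫ := by
      rw [inner_smul_right, real_inner_self_eq_norm_sq]; field_simp
    set n := ‖x - q‖⁻¹ • (x - q) with hn
    have hn1 : ‖n‖ = 1 := by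
      rw [hn, norm_smul, norm_inv, norm_norm, inv_mul_cancel₀ hd.ne']
    rw [hxq, dist_eq_norm, h2, show x - q = (x - p) + (p - q) by abel, inner_add_left]
    have h3 : ⟪p - q, n⟫ ≤ 2 * ‖x - p‖ ^ 2 / R := by
      rw [le_div_iff₀ hR]
      rw [hn1, norm_sub_rev] at h1
      nlinarith [norm_nonneg (q - p)]
    linarith

/-- Limits of unit normals at points converging to `p` are unit normals at `p`. -/
theorem exists_proxNormal_of_tendsto {S : Set E} {R : ℝ} {p v : E} {a C t₀ : ℝ} (ht₀ : 0 < t₀)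
    (h : ∀ t, 0 < t → t < t₀ → ∃ q, ‖q - p‖ ≤ C * t ∧ ∃ n ∈ proxNormals S R q, ‖n‖ = 1 ∧
      a - C * t ≤ ⟪v, n⟫) :
    ∃ n ∈ proxNormals S R p, ‖n‖ = 1 ∧ a ≤ ⟪v, n⟫ := by
  have hcl : IsClosed (Prod.fst '' {z : (ℝ × E) × E | z.2 ∈ proxNormals S R z.1.2 ∧ ‖z.2‖ = 1 ∧
      a - C * z.1.1 ≤ ⟪v, z.2⟫}) := by
    refine isClosed_image_fst_of_norm_eq_one ?_ fun z hz => hz.2.1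
    refine IsClosed.and ?_ (IsClosed.and ?_ ?_)
    · exact (isClosed_proxNormals_graph S R).preimage
        (by fun_prop : Continuous fun z : (ℝ × E) × E => (z.1.2, z.2))
    · exact isClosed_eq (by fun_prop) (by fun_prop)
    · exact isClosed_le (by fun_prop) (by fun_prop)
  have hmem : ((0 : ℝ), p) ∈ Prod.fst '' {z : (ℝ × E) × E | z.2 ∈ proxNormals S R z.1.2 ∧
      ‖z.2‖ = 1 ∧ a - C * z.1.1 ≤ ⟪v, z.2⟫} := by
    rw [← hcl.closure_eq, Metric.mem_closure_iff]
    intro ε hε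
    obtain ⟨t, ht, ht1, ht2, ht3⟩ : ∃ t, 0 < t ∧ t < t₀ ∧ t < ε ∧ C * t < ε := by
      refine ⟨min t₀ (ε / (|C| + 1)) / 2, by positivity, ?_, ?_, ?_⟩
      · linarith [min_le_left t₀ (ε / (|C| + 1)), lt_min ht₀ (by positivity : 0 < ε / (|C| + 1))]
      all_goals
        have h1 : min t₀ (ε / (|C| + 1)) * (|C| + 1) ≤ ε := by
          rw [← le_div_iff₀ (by positivity)]; exact min_le_right _ _
        have h2 : 0 < min t₀ (ε / (|C| + 1)) := by positivity
        nlinarith [le_abs_self C, abs_nonneg C]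
    obtain ⟨q, hq, n, hn, hn1, hv⟩ := h t ht ht1
    refine ⟨(t, q), ⟨((t, q), n), ⟨hn, hn1, hv⟩, rfl⟩, ?_⟩
    rw [Prod.dist_eq, max_lt_iff, dist_comm, dist_comm p, dist_eq_norm, dist_eq_norm]
    exact ⟨by simpa [abs_of_pos ht] using ht2, hq.trans_lt ht3⟩
  obtain ⟨⟨⟨s, q⟩, n⟩, ⟨hn, hn1, hv⟩, heq⟩ := hmem
  obtain ⟨rfl, rfl⟩ : s = 0 ∧ q = p := by simpa using heq
  exact ⟨n, hn, hn1, by simpa using hv⟩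

/-- At a point of a set without interior, no open half space contains all normals. -/
theorem exists_proxNormal_inner_nonneg {S : Set E} {R : ℝ} (hR : 0 < R) (hcl : IsClosed S)
    (h : UniformNormals S R) (hint : interior S = ∅) {p : E} (hp : p ∈ S) (v : E) :
    ∃ n ∈ proxNormals S R p, ‖n‖ = 1 ∧ 0 ≤ ⟪v, n⟫ := by
  refine exists_proxNormal_of_tendsto (t₀ := 1) (v := v)
    (C := 2 * (‖v‖ + 1) + 1 + 2 * (‖v‖ + 1) ^ 2 / R) one_pos fun t ht ht1 => ?_
  obtain ⟨x, hx, hxS⟩ : ∃ x ∈ ball (p + t • v) (t ^ 2), x ∉ S := by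
    by_contra! hc
    have h1 : p + t • v ∈ interior S :=
      mem_interior.2 ⟨_, hc, isOpen_ball, mem_ball_self (by positivity)⟩
    simp [hint] at h1
  obtain ⟨q, hq, n, hn, hn1, -, hqp, hi⟩ := exists_proxNormal_of_notMem hR hcl h hp hxS
  rw [mem_ball, dist_eq_norm] at hx
  have hxp : ‖x - p‖ ≤ t * (‖v‖ + 1) := by
    have h1 := norm_add_le (x - (p + t • v)) (t • v)
    rw [norm_smul, Real.norm_of_nonneg ht.le,
      show x - (p + t • v) + t • v = x - p by abel] at h1
    nlinarith
  have hC : 0 ≤ 2 * (‖v‖ + 1) ^ 2 / R := by positivity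
  refine ⟨q, ?_, n, hn, hn1, ?_⟩
  · nlinarith [norm_nonneg v]
  · have h1 : ⟪x - p, n⟫ ≤ t * ⟪v, n⟫ + t ^ 2 := by
      have h2 := real_inner_le_norm (x - (p + t • v)) n
      rw [hn1] at h2
      have h3 : ⟪x - p, n⟫ = ⟪x - (p + t • v), n⟫ + t * ⟪v, n⟫ := by
        rw [← real_inner_smul_left, ← inner_add_left]; congr 1; abel
      linarith
    have h2 : 2 * ‖x - p‖ ^ 2 / R ≤ t ^ 2 * (2 * (‖v‖ + 1) ^ 2 / R) := by
      rw [mul_div_assoc', div_le_div_iff_of_pos_right hR]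
      nlinarith [norm_nonneg (x - p), pow_le_pow_left₀ (norm_nonneg (x - p)) hxp 2]
    have h3 : 0 ≤ infDist x S := infDist_nonneg
    have h4 : 0 ≤ t * (⟪v, n⟫ + t + t * (2 * (‖v‖ + 1) ^ 2 / R)) := by nlinarith
    have h5 := nonneg_of_mul_nonneg_right h4 ht
    nlinarith [norm_nonneg v]

/-- A point outside a closed convex cone is separated from it by a vector of the polar cone. -/
theorem exists_polar_inner_pos {C : Set E} (hC : Convex ℝ C) (hcl : IsClosed C) (h0 : (0 : E) ∈ C)
    (hsmul : ∀ a : ℝ, 0 ≤ a → ∀ w ∈ C, a • w ∈ C) {x : E} (hx : x ∉ C) :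
    ∃ v, (∀ w ∈ C, ⟪v, w⟫ ≤ 0) ∧ 0 < ⟪v, x⟫ := by
  obtain ⟨f, u, hf, hu⟩ := geometric_hahn_banach_closed_point hC hcl hx
  have hv : ∀ w, ⟪(InnerProductSpace.toDual ℝ E).symm f, w⟫ = f w := fun w => by simp
  have hu0 : 0 < u := by simpa using hf 0 h0
  refine ⟨(InnerProductSpace.toDual ℝ E).symm f, fun w hw => ?_, ?_⟩
  · rw [hv]
    by_contra! hc
    have h1 := hf _ (hsmul (u / f w) (by positivity) w hw)
    rw [map_smul, smul_eq_mul, div_mul_cancel₀ _ hc.ne'] at h1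
    exact lt_irrefl _ h1
  · rw [hv]; linarith

theorem exists_antipodal_proxNormals {S : Set E} {R : ℝ} (hR : 0 < R) (hcl : IsClosed S)
    (h : UniformNormals S R) (hint : interior S = ∅) {p : E} (hp : p ∈ S) :
    ∃ n, ‖n‖ = 1 ∧ n ∈ proxNormals S R p ∧ -n ∈ proxNormals S R p := by
  by_contra! hc
  have hK : IsCompact (proxNormals S R p ∩ sphere 0 1) :=
    (isCompact_sphere 0 1).inter_left (isClosed_proxNormals S R p)
  obtain ⟨v, -, hv⟩ : ∃ v, (∀ w ∈ proxNormals S R p, ⟪v, w⟫ ≤ 0) ∧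
      ∀ w ∈ proxNormals S R p ∩ sphere 0 1, w ∈ proxNormals S R p → ⟪v, w⟫ < 0 := by
    refine hK.induction_on (p := fun s => ∃ v, (∀ w ∈ proxNormals S R p, ⟪v, w⟫ ≤ 0) ∧
      ∀ w ∈ s, w ∈ proxNormals S R p → ⟪v, w⟫ < 0) ?_ ?_ ?_ ?_
    · exact ⟨0, by simp, by simp⟩
    · rintro s t hst ⟨v, h1, h2⟩
      exact ⟨v, h1, fun w hw => h2 w (hst hw)⟩
    · rintro s t ⟨v₁, h₁, h₁'⟩ ⟨v₂, h₂, h₂'⟩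
      refine ⟨v₁ + v₂, fun w hw => ?_, ?_⟩
      · rw [inner_add_left]; linarith [h₁ w hw, h₂ w hw]
      · rintro w (hw | hw) hwS <;> rw [inner_add_left]
        · linarith [h₁' w hw hwS, h₂ w hwS]
        · linarith [h₁ w hwS, h₂' w hw hwS]
    · rintro n ⟨hn, hn1⟩
      obtain ⟨v, hv, hvn⟩ := exists_polar_inner_pos (convex_proxNormals hR h hp)
        (isClosed_proxNormals S R p) (zero_mem_proxNormals S R p)
        (fun a ha w hw => smul_mem_proxNormals ha hw) (hc n (by simpa using hn1) hn)
      rw [inner_neg_right, neg_pos] at hvn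
      refine ⟨{w | ⟪v, w⟫ < 0}, mem_nhdsWithin_of_mem_nhds ?_, v, hv, fun w hw _ => hw⟩
      exact (isOpen_lt (by fun_prop) (by fun_prop)).mem_nhds hvn
  obtain ⟨n, hn, hn1, hvn⟩ := exists_proxNormal_inner_nonneg hR hcl h hint hp v
  exact absurd (hv n ⟨hn, by simpa using hn1⟩ hn) (not_lt.2 hvn)

end Reach

section Plane

theorem orthonormalBasis_eq_add (b : OrthonormalBasis (Fin 2) ℝ E2) (w : E2) :
    w = ⟪b 0, w⟫ • b 0 + ⟪b 1, w⟫ • b 1 := by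
  have h := b.sum_repr' w
  rw [Fin.sum_univ_two] at h
  exact h.symm

theorem norm_sq_eq_inner_orthonormalBasis (b : OrthonormalBasis (Fin 2) ℝ E2) (w : E2) :
    ‖w‖ ^ 2 = ⟪b 0, w⟫ ^ 2 + ⟪b 1, w⟫ ^ 2 := by
  have h := b.sum_sq_norm_inner_right w
  simpa [Fin.sum_univ_two] using h.symm

theorem inner_eq_orthonormalBasis (b : OrthonormalBasis (Fin 2) ℝ E2) (w z : E2) :
    ⟪w, z⟫ = ⟪b 0, w⟫ * ⟪b 0, z⟫ + ⟪b 1, w⟫ * ⟪b 1, z⟫ := by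
  have h := b.sum_inner_mul_inner w z
  rw [Fin.sum_univ_two] at h
  rw [← h, real_inner_comm w, real_inner_comm w]

theorem exists_orthonormalBasis_one_eq {n : E2} (hn : ‖n‖ = 1) :
    ∃ b : OrthonormalBasis (Fin 2) ℝ E2, b 1 = n := by
  obtain ⟨b, hb⟩ := Orthonormal.exists_orthonormalBasis_extension_of_card_eq (𝕜 := ℝ) (E := E2)
    (ι := Fin 2) (v := fun _ => n) (s := {1}) (by simp) (by
      refine ⟨fun i => hn, fun i j hij => ?_⟩
      exact absurd (Subsingleton.elim i j) hij)
  exact ⟨b, hb 1 rfl⟩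

theorem exists_orthonormalBasis_neg_zero (b : OrthonormalBasis (Fin 2) ℝ E2) :
    ∃ b' : OrthonormalBasis (Fin 2) ℝ E2, b' 0 = -b 0 ∧ b' 1 = b 1 := by
  obtain ⟨b', hb'⟩ := Orthonormal.exists_orthonormalBasis_extension_of_card_eq (𝕜 := ℝ) (E := E2)
    (ι := Fin 2) (v := ![-b 0, b 1]) (s := univ) (by simp) 
    ((show Orthonormal ℝ ![-b 0, b 1] by
      rw [orthonormal_iff_ite]
      intro i j
      fin_cases i <;> fin_cases j <;> simp [b.inner_eq_ite]).comp _ Subtype.val_injective)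
  exact ⟨b', hb' 0 trivial, hb' 1 trivial⟩

variable {S : Set E2} {R : ℝ} {p : E2} {b : OrthonormalBasis (Fin 2) ℝ E2}

theorem smul_mem_proxNormals_of_antipodal {n : E2} (h1 : n ∈ proxNormals S R p)
    (h2 : -n ∈ proxNormals S R p) (a : ℝ) : a • n ∈ proxNormals S R p := by
  rcases le_total 0 a with ha | ha
  · exact smul_mem_proxNormals ha h1
  · rw [← neg_smul_neg]; exact smul_mem_proxNormals (neg_nonneg.2 ha) h2

theorem basis_zero_mem_proxNormals (hR : 0 < R) (h : UniformNormals S R) (hp : p ∈ S)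
    (h1 : b 1 ∈ proxNormals S R p) (h2 : -b 1 ∈ proxNormals S R p) {m : E2}
    (hm : m ∈ proxNormals S R p) (hm0 : 0 < ⟪b 0, m⟫) : b 0 ∈ proxNormals S R p := by
  have h3 : b 0 = ⟪b 0, m⟫⁻¹ • (m + (-⟪b 1, m⟫) • b 1) := by
    have h4 : m + (-⟪b 1, m⟫) • b 1 = ⟪b 0, m⟫ • b 0 := by
      rw [neg_smul, ← sub_eq_add_neg, sub_eq_iff_eq_add]
      exact orthonormalBasis_eq_add b m
    rw [h4, inv_smul_smul₀ hm0.ne']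
  rw [h3]
  exact smul_mem_proxNormals (inv_nonneg.2 hm0.le)
    (add_mem_proxNormals hR h hp hm (smul_mem_proxNormals_of_antipodal h1 h2 _))

theorem neg_basis_zero_mem_proxNormals (hR : 0 < R) (h : UniformNormals S R) (hp : p ∈ S)
    (h1 : b 1 ∈ proxNormals S R p) (h2 : -b 1 ∈ proxNormals S R p) {m : E2}
    (hm : m ∈ proxNormals S R p) (hm0 : ⟪b 0, m⟫ < 0) : -b 0 ∈ proxNormals S R p := by
  obtain ⟨b', h0', h1'⟩ := exists_orthonormalBasis_neg_zero b
  rw [← h0']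
  refine basis_zero_mem_proxNormals hR h hp ?_ ?_ hm ?_
  · rwa [h1']
  · rwa [h1']
  · rw [h0', inner_neg_left]; linarith

theorem mem_proxNormals_of_antipodal (hR : 0 < R) (h : UniformNormals S R) (hp : p ∈ S)
    (h1 : b 1 ∈ proxNormals S R p) (h2 : -b 1 ∈ proxNormals S R p) (h3 : b 0 ∈ proxNormals S R p)
    (h4 : -b 0 ∈ proxNormals S R p) (w : E2) : w ∈ proxNormals S R p := by
  rw [orthonormalBasis_eq_add b w]
  exact add_mem_proxNormals hR h hp (smul_mem_proxNormals_of_antipodal h3 h4 _)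
    (smul_mem_proxNormals_of_antipodal h1 h2 _)

/-- Near `p`, the set lies in a cone of slope one at each of its points. -/
theorem exists_abs_inner_le (hR : 0 < R) (h : UniformNormals S R)
    (hanti : ∀ q ∈ S, ∃ n, ‖n‖ = 1 ∧ n ∈ proxNormals S R q ∧ -n ∈ proxNormals S R q) (hp : p ∈ S)
    (h1 : b 1 ∈ proxNormals S R p) (h2 : -b 1 ∈ proxNormals S R p)
    (hne : ∃ w, w ∉ proxNormals S R p) :
    ∃ ρ > 0, ∀ q ∈ S, ‖q - p‖ < ρ → ∀ q' ∈ S, ‖q' - p‖ < ρ →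
      |⟪b 1, q' - q⟫| ≤ |⟪b 0, q' - q⟫| := by
  have hcl : IsClosed (Prod.fst '' {z : E2 × E2 | z.2 ∈ proxNormals S R z.1 ∧
      -z.2 ∈ proxNormals S R z.1 ∧ ‖z.2‖ = 1 ∧ 1 / 4 ≤ |⟪b 0, z.2⟫|}) := by
    refine isClosed_image_fst_of_norm_eq_one ?_ fun z hz => hz.2.2.1
    refine (isClosed_proxNormals_graph S R).and (IsClosed.and ?_ (IsClosed.and ?_ ?_))
    · exact (isClosed_proxNormals_graph S R).preimage
        (by fun_prop : Continuous fun z : E2 × E2 => (z.1, -z.2))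
    · exact isClosed_eq (by fun_prop) (by fun_prop)
    · exact isClosed_le (by fun_prop) (by fun_prop)
  have hpn : p ∉ Prod.fst '' {z : E2 × E2 | z.2 ∈ proxNormals S R z.1 ∧
      -z.2 ∈ proxNormals S R z.1 ∧ ‖z.2‖ = 1 ∧ 1 / 4 ≤ |⟪b 0, z.2⟫|} := by
    rintro ⟨⟨q, m⟩, ⟨hm, hm', -, hm1⟩, rfl⟩
    obtain ⟨w, hw⟩ := hne
    refine hw ?_
    have hm0 : ⟪b 0, m⟫ ≠ 0 := by intro h0; simp only [h0, abs_zero] at hm1; linarith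
    have hm0' : ⟪b 0, -m⟫ = -⟪b 0, m⟫ := inner_neg_right _ _
    rcases hm0.lt_or_gt with h0 | h0
    · exact mem_proxNormals_of_antipodal hR h hp h1 h2
        (basis_zero_mem_proxNormals hR h hp h1 h2 hm' (by linarith))
        (neg_basis_zero_mem_proxNormals hR h hp h1 h2 hm h0) w
    · exact mem_proxNormals_of_antipodal hR h hp h1 h2
        (basis_zero_mem_proxNormals hR h hp h1 h2 hm h0)
        (neg_basis_zero_mem_proxNormals hR h hp h1 h2 hm' (by linarith)) w
  obtain ⟨ρ, hρ, hball⟩ := Metric.isOpen_iff.1 hcl.isOpen_compl p hpn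
  refine ⟨min ρ (R / 8), by positivity, fun q hq hqp q' hq' hqp' => ?_⟩
  obtain ⟨m, hm1, hm, hm'⟩ := hanti q hq
  have hmb : |⟪b 0, m⟫| < 1 / 4 := by
    by_contra! hc
    refine hball (a := q) ?_ ⟨(q, m), ⟨hm, hm', hm1, hc⟩, rfl⟩
    rw [mem_ball, dist_eq_norm]; exact hqp.trans_le (min_le_left _ _)
  have hd : ‖q' - q‖ ≤ R / 4 := by
    have h3 := norm_sub_le (q' - p) (q - p)
    rw [sub_sub_sub_cancel_right] at h3
    linarith [min_le_right ρ (R / 8)]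
  have h3 := hm q' hq'
  have h4 := hm' q' hq'
  rw [inner_neg_right, norm_neg] at h4
  rw [hm1, inner_eq_orthonormalBasis b] at h3 h4
  have h5 := norm_sq_eq_inner_orthonormalBasis b (q' - q)
  have h6 := norm_sq_eq_inner_orthonormalBasis b m
  rw [hm1] at h6
  set X := ⟪b 0, q' - q⟫
  set Y := ⟪b 1, q' - q⟫
  set x := ⟪b 0, m⟫
  set y := ⟪b 1, m⟫
  have hN : ‖q' - q‖ ≤ |X| + |Y| := by
    refine abs_le_of_sq_le_sq' ?_ (by positivity) |>.2
    nlinarith [sq_abs X, sq_abs Y, mul_nonneg (abs_nonneg X) (abs_nonneg Y)]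
  have h7 : |X * x + Y * y| ≤ (|X| + |Y|) / 8 := by
    have h8 : ‖q' - q‖ ^ 2 ≤ (R / 4) * (|X| + |Y|) := by
      rw [pow_two]; exact mul_le_mul hd hN (norm_nonneg _) (by positivity)
    rw [abs_le]
    constructor <;> nlinarith
  have h8 : |Y| * |y| ≤ (|X| + |Y|) / 8 + |X| * (1 / 4) := by
    rw [← abs_mul]
    have h9 := abs_sub_le_iff.1 (abs_abs_sub_abs_le (X * x + Y * y) (X * x))
    have h10 : |X * x| ≤ |X| * (1 / 4) := by
      rw [abs_mul]; exact mul_le_mul_of_nonneg_left hmb.le (abs_nonneg _)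
    have h11 := abs_sub (X * x + Y * y) (X * x)
    rw [add_sub_cancel_left] at h11
    linarith
  have h9 : 9 / 10 ≤ |y| := by
    by_contra! hc
    nlinarith [sq_abs x, sq_abs y, abs_nonneg x, abs_nonneg y]
  nlinarith [abs_nonneg X, abs_nonneg Y]

/-- The projection of `S` near `p` onto the first axis has no two gaps separated by a point. -/
theorem mem_projection_or (hconn : IsPreconnected S) {ρ : ℝ} {q₀ : E2} (hq₀ : q₀ ∈ S)
    (hρ : ρ ≤ ‖q₀ - p‖) (hcone : ∀ q ∈ S, ‖q - p‖ < ρ → |⟪b 1, q - p⟫| ≤ |⟪b 0, q - p⟫|)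
    {x₁ x₂ : ℝ} (hx₁ : -(ρ / 2) < x₁) (hx₂ : x₂ < ρ / 2) {q : E2} (hq : q ∈ S) (hqp : ‖q - p‖ < ρ)
    (h1 : x₁ < ⟪b 0, q - p⟫) (h2 : ⟪b 0, q - p⟫ < x₂) :
    (∃ z ∈ S, ‖z - p‖ < ρ ∧ ⟪b 0, z - p⟫ = x₁) ∨ ∃ z ∈ S, ‖z - p‖ < ρ ∧ ⟪b 0, z - p⟫ = x₂ := by
  by_contra! hc
  obtain ⟨hc₁, hc₂⟩ := hc
  have hρ0 : 0 < ρ := (norm_nonneg _).trans_lt hqp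
  have hX : Continuous fun z => ⟪b 0, z - p⟫ := by fun_prop
  have hn : Continuous fun z => ‖z - p‖ := by fun_prop
  let V : Set E2 := {z | ‖z - p‖ < ρ} ∩ ({z | x₁ < ⟪b 0, z - p⟫} ∩ {z | ⟪b 0, z - p⟫ < x₂})
  let W : Set E2 := {z | 3 / 4 * ρ < ‖z - p‖} ∪ ({z | ⟪b 0, z - p⟫ < x₁} ∪ {z | x₂ < ⟪b 0, z - p⟫})
  have hV : IsOpen V := (isOpen_lt hn continuous_const).inter
    ((isOpen_lt continuous_const hX).inter (isOpen_lt hX continuous_const))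
  have hW : IsOpen W := (isOpen_lt continuous_const hn).union
    ((isOpen_lt hX continuous_const).union (isOpen_lt continuous_const hX))
  obtain ⟨z, hz, ⟨hzρ, hz1, hz2⟩, hzW⟩ := hconn V W hV hW (fun z hz => by
      by_cases hzW : z ∈ W
      · exact Or.inr hzW
      · simp only [W, mem_union, mem_ofPred_eq, not_or, not_lt] at hzW
        have hzρ : ‖z - p‖ < ρ := by linarith
        exact Or.inl ⟨hzρ, lt_of_le_of_ne hzW.2.1 (hc₁ z hz hzρ).symm,
          lt_of_le_of_ne hzW.2.2 (hc₂ z hz hzρ)⟩)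
    ⟨q, hq, hqp, h1, h2⟩ ⟨q₀, hq₀, Or.inl (by simp only [mem_ofPred_eq]; linarith)⟩
  simp only [mem_ofPred_eq] at hzρ hz1 hz2
  simp only [W, mem_union, mem_ofPred_eq] at hzW
  rcases hzW with hzW | hzW | hzW
  · have h3 := hcone z hz hzρ
    have h4 := norm_sq_eq_inner_orthonormalBasis b (z - p)
    have h5 : |⟪b 0, z - p⟫| < ρ / 2 := abs_lt.2 ⟨by linarith, by linarith⟩
    have h6 := sq_le_sq.2 h3
    have h7 := sq_lt_sq.2 (h5.trans_le (le_abs_self _))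
    nlinarith
  · linarith
  · linarith

theorem exists_local_shape {A : Set ℝ} {δ : ℝ} (hδ : 0 < δ) (h0 : (0 : ℝ) ∈ A)
    (hA : ∀ x₁ x₂ a, -δ < x₁ → x₂ < δ → a ∈ A → x₁ < a → a < x₂ → x₁ ∈ A ∨ x₂ ∈ A) :
    ∃ c > 0, c ≤ δ ∧ (A ∩ Ioo (-c) c = Ioo (-c) c ∨ A ∩ Ioo (-c) c = Ico 0 c ∨
      A ∩ Ioo (-c) c = Ioc (-c) 0) := by
  by_cases hpos : ∃ c > 0, c ≤ δ ∧ ∀ x, 0 < x → x < c → x ∈ A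
  · obtain ⟨c, hc, hcδ, hcA⟩ := hpos
    by_cases hneg : ∃ d > 0, d ≤ c ∧ ∀ x, -d < x → x < 0 → x ∈ A
    · obtain ⟨d, hd, hdc, hdA⟩ := hneg
      refine ⟨d, hd, hdc.trans hcδ, Or.inl (inter_eq_right.2 fun x hx => ?_)⟩
      rcases lt_trichotomy x 0 with h | rfl | h
      · exact hdA x hx.1 h
      · exact h0
      · exact hcA x h (hx.2.trans_le hdc)
    · push Not at hneg
      obtain ⟨x₁, hx₁, hx₁0, hx₁A⟩ := hneg c hc le_rfl
      refine ⟨-x₁, by linarith, by linarith, Or.inr (Or.inl ?_)⟩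
      ext x
      simp only [mem_inter_iff, mem_Ioo, mem_Ico, neg_neg]
      refine ⟨fun ⟨hxA, hx1, hx2⟩ => ⟨?_, hx2⟩, fun ⟨hx1, hx2⟩ => ⟨?_, by linarith, hx2⟩⟩
      · by_contra! hx0
        obtain ⟨x₂, hx₂, hx₂0, hx₂A⟩ := hneg (-x) (by linarith) (by linarith)
        exact (hA x₁ x₂ x (by linarith) (by linarith) hxA hx1 (by linarith)).elim hx₁A hx₂A
      · rcases hx1.eq_or_lt with rfl | h
        · exact h0
        · exact hcA x h (by linarith)
  · push Not at hpos
    obtain ⟨x₂, hx₂, hx₂δ, hx₂A⟩ := hpos δ hδ le_rfl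
    refine ⟨x₂, hx₂, hx₂δ.le, Or.inr (Or.inr ?_)⟩
    ext x
    simp only [mem_inter_iff, mem_Ioo, mem_Ioc]
    refine ⟨fun ⟨hxA, hx1, hx2⟩ => ⟨hx1, ?_⟩, fun ⟨hx1, hx2⟩ => ⟨?_, hx1, by linarith⟩⟩
    · by_contra! hx0
      obtain ⟨x₁, hx₁, hx₁0, hx₁A⟩ := hpos x hx0 (by linarith)
      exact (hA x₁ x₂ x (by linarith) hx₂δ hxA hx₁0 hx2).elim hx₁A hx₂A
    · rcases hx2.eq_or_lt with rfl | h
      · exact h0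
      · exact (hA x x₂ 0 (by linarith) hx₂δ h0 h hx₂).resolve_right hx₂A

end Plane

section Endpoints

variable {S : Set E2} {r : ℝ} {p : E2} {b : OrthonormalBasis (Fin 2) ℝ E2}

theorem add_smul_mem_contactSet_iff (hr : 0 < r) (hp : p ∈ S) {w : E2} (hw : ‖w‖ = 1) :
    p + r • w ∈ contactSet S r p ↔ w ∈ proxNormals S r p := by
  have hN : w ∈ proxNormals S r p ↔ infDist (p + r • w) S = r := by
    rw [infDist_add_smul_eq_iff hp hw hr.le]; simp [proxNormals, hw]
  rw [hN]
  constructor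
  · rintro ⟨-, h⟩
    exact frontier_lt_subset_eq (continuous_infDist_pt S) continuous_const h
  · intro h
    refine ⟨by simp [norm_smul, hw, abs_of_pos hr], ?_⟩
    have hopen : IsOpen {x | infDist x S < r} :=
      isOpen_lt (continuous_infDist_pt S) continuous_const
    rw [hopen.frontier_eq]
    refine ⟨?_, fun h' : infDist (p + r • w) S < r => h'.ne h⟩
    rw [Metric.mem_closure_iff]
    intro ε hε
    obtain ⟨s, hs0, hsr, hsε⟩ : ∃ s, 0 < s ∧ s < r ∧ r - s < ε := by
      refine ⟨max (r / 2) (r - ε / 2), by positivity, max_lt (by linarith) (by linarith), ?_⟩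
      linarith [le_max_right (r / 2) (r - ε / 2)]
    refine ⟨p + s • w, ?_, ?_⟩
    · refine (infDist_le_dist_of_mem hp).trans_lt ?_
      simpa [norm_smul, hw, abs_of_pos hs0] using hsr
    · rw [dist_add_left, dist_eq_norm, ← sub_smul, norm_smul, hw, mul_one,
        Real.norm_of_nonneg (by linarith)]
      exact hsε

theorem exists_eq_add_smul_of_mem_contactSet (hr : 0 < r) {y : E2} (hy : y ∈ contactSet S r p) :
    ∃ w : E2, ‖w‖ = 1 ∧ y = p + r • w := by
  have h1 : ‖y - p‖ = r := by simpa [dist_eq_norm] using hy.1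
  refine ⟨r⁻¹ • (y - p), ?_, ?_⟩
  · rw [norm_smul, h1, Real.norm_of_nonneg (by positivity), inv_mul_cancel₀ hr.ne']
  · rw [smul_inv_smul₀ hr.ne']; abel

/-- If the normals at `p` are the unit vectors of a half plane, then `p` is an endpoint. -/
theorem mem_semiSet_of_neg_mem (hr : 0 < r) (h : UniformNormals S r) (hp : p ∈ S)
    (h1 : b 1 ∈ proxNormals S r p) (h2 : -b 1 ∈ proxNormals S r p)
    (h3 : -b 0 ∈ proxNormals S r p) (hne : ∃ w, w ∉ proxNormals S r p) : p ∈ semiSet S r := by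
  have h01 : ⟪b 1, b 0⟫ = 0 := by simp [b.inner_eq_ite]
  have h10 : ⟪b 0, b 1⟫ = 0 := by simp [b.inner_eq_ite]
  refine ⟨hp, b 1, -b 0, by simp, by simp, by simp [h01], ?_⟩
  rw [mul_div_assoc, div_self hr.ne', mul_one]
  have hparam : ∀ θ : ℝ, p + (r * cos θ) • b 1 + (r * sin θ) • (-b 0) =
      p + r • (cos θ • b 1 + sin θ • (-b 0)) := by
    intro θ; rw [smul_add, smul_smul, smul_smul, add_assoc]
  simp only [hparam]
  ext y
  constructor
  · intro hy
    obtain ⟨w, hw, rfl⟩ := exists_eq_add_smul_of_mem_contactSet hr hy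
    rw [add_smul_mem_contactSet_iff hr hp hw] at hy
    have hw0 : ⟪b 0, w⟫ ≤ 0 := by
      by_contra! hc
      obtain ⟨z, hz⟩ := hne
      exact hz (mem_proxNormals_of_antipodal hr h hp h1 h2
        (basis_zero_mem_proxNormals hr h hp h1 h2 hy hc) h3 z)
    have hsq := norm_sq_eq_inner_orthonormalBasis b w
    rw [hw] at hsq
    have hle : |⟪b 1, w⟫| ≤ 1 := by
      rw [← sq_le_one_iff_abs_le_one]; nlinarith
    refine ⟨arccos ⟪b 1, w⟫, ⟨arccos_nonneg _, arccos_le_pi _⟩, ?_⟩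
    simp only
    congr 2
    rw [cos_arccos (abs_le.1 hle).1 (abs_le.1 hle).2, sin_arccos,
      show 1 - ⟪b 1, w⟫ ^ 2 = (-⟪b 0, w⟫) ^ 2 by linarith, sqrt_sq (by linarith), neg_smul_neg,
      add_comm]
    exact (orthonormalBasis_eq_add b w).symm
  · rintro ⟨θ, ⟨hθ0, hθπ⟩, rfl⟩
    have hw : ‖cos θ • b 1 + sin θ • (-b 0)‖ = 1 := by
      have hsq := norm_sq_eq_inner_orthonormalBasis b (cos θ • b 1 + sin θ • (-b 0))
      simp only [inner_add_right, inner_smul_right, inner_neg_right, h01, h10,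
        real_inner_self_eq_norm_sq, b.norm_eq_one] at hsq
      have h4 : ‖cos θ • b 1 + sin θ • (-b 0)‖ ^ 2 = 1 := by
        rw [hsq]; nlinarith [sin_sq_add_cos_sq θ]
      exact (pow_eq_one_iff_of_nonneg (norm_nonneg _) two_ne_zero).1 h4
    refine (add_smul_mem_contactSet_iff hr hp hw).2 ?_
    exact add_mem_proxNormals hr h hp (smul_mem_proxNormals_of_antipodal h1 h2 _)
      (smul_mem_proxNormals (sin_nonneg_of_nonneg_of_le_pi hθ0 hθπ) h3)

theorem mem_or_neg_mem_of_mem_semiSet (hr : 0 < r) (h : UniformNormals S r)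
    (h1 : b 1 ∈ proxNormals S r p) (h2 : -b 1 ∈ proxNormals S r p) (hs : p ∈ semiSet S r) :
    b 0 ∈ proxNormals S r p ∨ -b 0 ∈ proxNormals S r p := by
  obtain ⟨hp, u, v, hu, hv, huv, harc⟩ := hs
  rw [mul_div_assoc, div_self hr.ne', mul_one] at harc
  have hmem : ∀ {w : E2}, ‖w‖ = 1 → (∃ θ ∈ Icc 0 π, cos θ • u + sin θ • v = w) →
      w ∈ proxNormals S r p := by
    rintro w hw ⟨θ, hθ, rfl⟩
    rw [← add_smul_mem_contactSet_iff hr hp hw, harc]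
    exact ⟨θ, hθ, by simp only [smul_add, smul_smul, add_assoc]⟩
  have hu' : u ∈ proxNormals S r p := hmem hu ⟨0, ⟨le_rfl, pi_nonneg⟩, by simp⟩
  have hv' : v ∈ proxNormals S r p :=
    hmem hv ⟨π / 2, ⟨by positivity, by linarith [pi_pos]⟩, by simp⟩
  have key : ∀ m ∈ proxNormals S r p, ⟪b 0, m⟫ ≠ 0 →
      b 0 ∈ proxNormals S r p ∨ -b 0 ∈ proxNormals S r p := by
    intro m hm hm0
    rcases hm0.lt_or_gt with hlt | hgt
    · exact Or.inr (neg_basis_zero_mem_proxNormals hr h hp h1 h2 hm hlt)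
    · exact Or.inl (basis_zero_mem_proxNormals hr h hp h1 h2 hm hgt)
  by_cases hu0 : ⟪b 0, u⟫ = 0
  · refine key v hv' fun hv0 => ?_
    have h3 := norm_sq_eq_inner_orthonormalBasis b u
    have h4 := norm_sq_eq_inner_orthonormalBasis b v
    rw [inner_eq_orthonormalBasis b, hu0, hv0] at huv
    rw [hu, hu0] at h3
    rw [hv, hv0] at h4
    have h5 : ⟪b 1, u⟫ * ⟪b 1, v⟫ = 0 := by linarith
    rcases mul_eq_zero.1 h5 with h6 | h6
    · rw [h6] at h3; norm_num at h3
    · rw [h6] at h4; norm_num at h4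
  · exact key u hu' hu0

/-- If `S` lies on one side of `p` along the first axis, then the opposite direction is normal. -/
theorem neg_basis_zero_mem_of_nonneg (hr : 0 < r) (hcl : IsClosed S) (h : UniformNormals S r)
    (hp : p ∈ S) {δ : ℝ} (hδ : 0 < δ) (hside : ∀ q ∈ S, ‖q - p‖ < δ → 0 ≤ ⟪b 0, q - p⟫) :
    -b 0 ∈ proxNormals S r p := by
  have hb0 : ‖b 0‖ = 1 := b.norm_eq_one 0
  obtain ⟨n, hn, hn1, hi⟩ : ∃ n ∈ proxNormals S r p, ‖n‖ = 1 ∧ 1 ≤ ⟪-b 0, n⟫ := by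
    refine exists_proxNormal_of_tendsto (t₀ := δ / 2) (C := 2 + 2 / r) (by positivity)
      fun t ht htδ => ?_
    have hxp : p + t • (-b 0) - p = t • (-b 0) := add_sub_cancel_left _ _
    have hxn : ‖p + t • (-b 0) - p‖ = t := by
      rw [hxp, norm_smul, norm_neg, hb0, mul_one, Real.norm_of_nonneg ht.le]
    have hx : p + t • (-b 0) ∉ S := by
      intro hx
      have h1 := hside _ hx (by rw [hxn]; linarith)
      rw [hxp, inner_smul_right, inner_neg_right, real_inner_self_eq_norm_sq, hb0] at h1
      linarith
    obtain ⟨q, hq, n, hn, hn1, hxq, hqp, hi⟩ := exists_proxNormal_of_notMem hr hcl h hp hx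
    rw [hxn] at hqp hi
    rw [hxp, inner_smul_left] at hi
    have hqs := hside q hq (by linarith)
    have htd : t ≤ infDist (p + t • (-b 0)) S := by
      rw [← hxq, dist_eq_norm, norm_sub_rev]
      have h1 := real_inner_le_norm (b 0) (q - (p + t • (-b 0)))
      rw [hb0, one_mul, show q - (p + t • (-b 0)) = (q - p) + t • b 0 by rw [smul_neg]; abel,
        inner_add_right, inner_smul_right, real_inner_self_eq_norm_sq, hb0] at h1
      rw [show q - (p + t • (-b 0)) = (q - p) + t • b 0 by rw [smul_neg]; abel]
      linarith
    refine ⟨q, ?_, n, hn, hn1, ?_⟩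
    · have : 0 < 2 / r := by positivity
      nlinarith
    · have h1 : t ≤ t * (⟪-b 0, n⟫ + 2 / r * t) := by
        have h2 : t * (⟪-b 0, n⟫ + 2 / r * t) = t * ⟪-b 0, n⟫ + 2 * t ^ 2 / r := by ring
        rw [h2]
        simpa using htd.trans hi
      have h3 : 1 ≤ ⟪-b 0, n⟫ + 2 / r * t := by
        by_contra! hc
        nlinarith
      linarith
  have h1 : ⟪-b 0, n⟫ = 1 := by
    refine le_antisymm ?_ hi
    have := real_inner_le_norm (-b 0) n
    rwa [norm_neg, hb0, hn1, one_mul] at this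
  rw [inner_eq_one_iff_of_norm_eq_one (by rw [norm_neg, hb0]) hn1] at h1
  rwa [h1]

/-- A graph over an open interval around `p` has no normal along the first axis. -/
theorem notMem_semiSet_of_twoSided (hr : 0 < r) (h : UniformNormals S r)
    (h1 : b 1 ∈ proxNormals S r p) (h2 : -b 1 ∈ proxNormals S r p) {c : ℝ} (hc : 0 < c)
    (hgraph : ∀ x ∈ Ioo (-c) c, ∃ q ∈ S, ⟪b 0, q - p⟫ = x ∧ |⟪b 1, q - p⟫| ≤ |x|) :
    p ∉ semiSet S r := by
  intro hs
  have key : ∀ x ∈ Ioo (-c) c, ∃ q ∈ S, ⟪q - p, b 0⟫ = x ∧ ‖q - p‖ ^ 2 ≤ 2 * x ^ 2 := by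
    intro x hx
    obtain ⟨q, hq, hqx, hqy⟩ := hgraph x hx
    refine ⟨q, hq, by rw [real_inner_comm, hqx], ?_⟩
    rw [norm_sq_eq_inner_orthonormalBasis b, hqx]
    linarith [sq_le_sq.2 hqy]
  have ht : 0 < min c r / 2 := by positivity
  have htc : min c r / 2 < c := by linarith [min_le_left c r]
  have htr : min c r / 2 < r := by linarith [min_le_right c r]
  rcases mem_or_neg_mem_of_mem_semiSet hr h h1 h2 hs with h3 | h3
  · obtain ⟨q, hq, hqx, hqn⟩ := key (min c r / 2) ⟨by linarith, htc⟩
    have h4 := h3 q hq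
    rw [b.norm_eq_one, hqx] at h4
    nlinarith
  · obtain ⟨q, hq, hqx, hqn⟩ := key (-(min c r / 2)) ⟨by linarith, by linarith⟩
    have h4 := h3 q hq
    rw [norm_neg, b.norm_eq_one, inner_neg_right, hqx] at h4
    nlinarith

end Endpoints

section Graph

variable {S : Set E2} {p : E2}

theorem exists_local_graph_of_shape {b : OrthonormalBasis (Fin 2) ℝ E2} {ρ c : ℝ} (hp : p ∈ S)
    (hρ : 0 < ρ) (hc : 0 < c)
    (hcone : ∀ q ∈ S, ‖q - p‖ < ρ → ∀ q' ∈ S, ‖q' - p‖ < ρ →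
      |⟪b 1, q' - q⟫| ≤ |⟪b 0, q' - q⟫|) :
    ∃ (e : E2 ≃ᵃⁱ[ℝ] E2) (U : Set E2) (g : ℝ → ℝ), IsOpen U ∧ p ∈ U ∧ LipschitzWith 1 g ∧
      e p = pt 0 (g 0) ∧
      e '' (S ∩ U) = (fun t => pt t (g t)) ''
        ({x | ∃ q ∈ S, ‖q - p‖ < ρ ∧ ⟪b 0, q - p⟫ = x} ∩ Ioo (-c) c) := by
  set A : Set ℝ := {x | ∃ q ∈ S, ‖q - p‖ < ρ ∧ ⟪b 0, q - p⟫ = x} with hA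
  choose! f hfS hfρ hfx using fun x (hx : x ∈ A) => hx
  have hsub : ∀ (i : Fin 2) (q q' : E2), ⟪b i, q' - p⟫ - ⟪b i, q - p⟫ = ⟪b i, q' - q⟫ := by
    intro i q q'; rw [← inner_sub_right, sub_sub_sub_cancel_right]
  have hLip : LipschitzOnWith 1 (fun x => ⟪b 1, f x - p⟫) A := by
    refine LipschitzOnWith.of_dist_le_mul fun x hx y hy => ?_
    rw [NNReal.coe_one, one_mul, Real.dist_eq, Real.dist_eq, hsub]
    refine (hcone _ (hfS y hy) (hfρ y hy) _ (hfS x hx) (hfρ x hx)).trans_eq ?_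
    rw [← hsub, hfx x hx, hfx y hy]
  obtain ⟨g, hg, hgeq⟩ := hLip.extend_real
  have hval : ∀ q ∈ S, ‖q - p‖ < ρ → ⟪b 1, q - p⟫ = g ⟪b 0, q - p⟫ := by
    intro q hq hqρ
    have hqA : ⟪b 0, q - p⟫ ∈ A := ⟨q, hq, hqρ, rfl⟩
    have h1 := hcone _ (hfS _ hqA) (hfρ _ hqA) q hq hqρ
    rw [← hsub 1 (f _) q, ← hsub 0 (f _) q, hfx _ hqA, sub_self ⟪b 0, q - p⟫, abs_zero, abs_nonpos_iff, sub_eq_zero] at h1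
    rw [h1]; exact hgeq hqA
  let e : E2 ≃ᵃⁱ[ℝ] E2 :=
    (AffineIsometryEquiv.vaddConst ℝ p).symm.trans b.repr.toAffineIsometryEquiv
  have he : ∀ q, e q = pt ⟪b 0, q - p⟫ ⟪b 1, q - p⟫ := by
    intro q
    ext i
    fin_cases i <;> simp [e, pt, b.repr_apply_apply, inner_sub_right]
  refine ⟨e, {q | ‖q - p‖ < ρ} ∩ {q | ⟪b 0, q - p⟫ ∈ Ioo (-c) c}, g, ?_, ?_, hg, ?_, ?_⟩
  · refine (isOpen_lt (by fun_prop) continuous_const).inter (isOpen_Ioo.preimage ?_)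
    fun_prop
  · exact ⟨by simpa using hρ, by simpa using hc⟩
  · have h1 := hval p hp (by simpa using hρ)
    rw [he, h1]; simp
  · ext y
    constructor
    · rintro ⟨q, ⟨hq, hqρ, hqc⟩, rfl⟩
      exact ⟨⟪b 0, q - p⟫, ⟨⟨q, hq, hqρ, rfl⟩, hqc⟩, by rw [he, hval q hq hqρ]⟩
    · rintro ⟨x, ⟨⟨q, hq, hqρ, rfl⟩, hqc⟩, rfl⟩
      exact ⟨q, ⟨hq, hqρ, hqc⟩, by rw [he, hval q hq hqρ]⟩

/-- In suitable coordinates, the set is locally a Lipschitz graph over an interval which is open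
or starts at `p`. -/
theorem exists_frame_and_shape {R : ℝ} (hR : 0 < R) (hcl : IsClosed S) (h : UniformNormals S R)
    (hint : interior S = ∅) (hconn : IsPreconnected S) (hp : p ∈ S) {q₀ : E2} (hq₀ : q₀ ∈ S)
    (hq₀p : q₀ ≠ p) :
    ∃ (b : OrthonormalBasis (Fin 2) ℝ E2) (ρ c : ℝ), 0 < ρ ∧ 0 < c ∧ c ≤ ρ / 2 ∧
      b 1 ∈ proxNormals S R p ∧ -b 1 ∈ proxNormals S R p ∧
      (∀ q ∈ S, ‖q - p‖ < ρ → ∀ q' ∈ S, ‖q' - p‖ < ρ → |⟪b 1, q' - q⟫| ≤ |⟪b 0, q' - q⟫|) ∧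
      ({x | ∃ q ∈ S, ‖q - p‖ < ρ ∧ ⟪b 0, q - p⟫ = x} ∩ Ioo (-c) c = Ioo (-c) c ∨
       {x | ∃ q ∈ S, ‖q - p‖ < ρ ∧ ⟪b 0, q - p⟫ = x} ∩ Ioo (-c) c = Ico 0 c) := by
  obtain ⟨n, hn, hn1, hn2⟩ := exists_antipodal_proxNormals hR hcl h hint hp
  obtain ⟨b, rfl⟩ := exists_orthonormalBasis_one_eq hn
  obtain ⟨ρ₀, hρ₀, hcone₀⟩ := exists_abs_inner_le hR h
    (fun q hq => exists_antipodal_proxNormals hR hcl h hint hq) hp hn1 hn2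
    (exists_notMem_proxNormals hR hconn hp hq₀ hq₀p)
  have hd : 0 < ‖q₀ - p‖ := norm_pos_iff.2 (sub_ne_zero.2 hq₀p)
  obtain ⟨ρ, hρ, hρ₀', hρd⟩ : ∃ ρ, 0 < ρ ∧ ρ ≤ ρ₀ ∧ ρ ≤ ‖q₀ - p‖ :=
    ⟨min ρ₀ ‖q₀ - p‖, lt_min hρ₀ hd, min_le_left _ _, min_le_right _ _⟩
  have hcone : ∀ q ∈ S, ‖q - p‖ < ρ → ∀ q' ∈ S, ‖q' - p‖ < ρ →
      |⟪b 1, q' - q⟫| ≤ |⟪b 0, q' - q⟫| := fun q hq hqρ q' hq' hqρ' =>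
    hcone₀ q hq (hqρ.trans_le hρ₀') q' hq' (hqρ'.trans_le hρ₀')
  have hpρ : ‖p - p‖ < ρ := by simpa using hρ
  obtain ⟨c, hc, hcρ, hshape⟩ := exists_local_shape
    (A := {x | ∃ q ∈ S, ‖q - p‖ < ρ ∧ ⟪b 0, q - p⟫ = x}) (half_pos hρ) ⟨p, hp, hpρ, by simp⟩ (by
      rintro x₁ x₂ _ hx₁ hx₂ ⟨q, hq, hqρ, rfl⟩ h1 h2
      exact mem_projection_or hconn hq₀ hρd (fun q hq hqρ => hcone p hp hpρ q hq hqρ)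
        hx₁ hx₂ hq hqρ h1 h2)
  rcases hshape with hs | hs | hs
  · exact ⟨b, ρ, c, hρ, hc, hcρ, hn1, hn2, hcone, Or.inl hs⟩
  · exact ⟨b, ρ, c, hρ, hc, hcρ, hn1, hn2, hcone, Or.inr hs⟩
  · obtain ⟨b', h0, h1⟩ := exists_orthonormalBasis_neg_zero b
    refine ⟨b', ρ, c, hρ, hc, hcρ, by rwa [h1], by rwa [h1], ?_, Or.inr ?_⟩
    · simpa only [h0, h1, inner_neg_left, abs_neg] using hcone
    · ext x
      have hx := Set.ext_iff.1 hs (-x)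
      simp only [mem_inter_iff, mem_ofPred_eq, mem_Ioo, mem_Ioc, mem_Ico, h0, inner_neg_left,
        neg_eq_iff_eq_neg] at hx ⊢
      constructor
      · rintro ⟨hA, hx1, hx2⟩
        have h3 := hx.1 ⟨hA, by linarith, by linarith⟩
        exact ⟨by linarith [h3.2], hx2⟩
      · rintro ⟨hx1, hx2⟩
        have h3 := hx.2 ⟨by linarith, by linarith⟩
        exact ⟨h3.1, by linarith, hx2⟩

end Graph

/-- **Step 1 of Theorem 1.1.** Let `S ⊆ ℝ²` be nonempty, closed, connected, with empty
interior, proximally `C¹` of radius `r_S > 0` and not a singleton; fix `r ∈ (0, r_S)` and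
let `S* := {p ∈ S : C_r(p) is a closed semicircumference}`. Then `S` is a `1`-dimensional
Lipschitz manifold with (possibly empty) boundary `S*`: near each `p ∈ S \ S*`, in
suitable orthonormal coordinates, `S` is the graph of a Lipschitz function over an open
interval, while near each `p ∈ S*` it is such a graph over a half-open interval whose
endpoint corresponds to `p`. -/
theorem stmt16 (S : Set E2) (rS : ℝ) (hrS : 0 < rS)
    (hne : S.Nonempty) (hcl : IsClosed S) (hconn : IsConnected S)
    (hint : interior S = ∅)
    (hprox : ContDiffOn ℝ 1 (fun x => infDist x S)
      {x | 0 < infDist x S ∧ infDist x S < rS})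
    (hnotsing : ¬ ∃ p, S = {p})
    (r : ℝ) (hr : r ∈ Set.Ioo 0 rS) :
    ∀ p ∈ S,
      (p ∉ semiSet S r →
        ∃ (e : E2 ≃ᵃⁱ[ℝ] E2) (U : Set E2) (g : ℝ → ℝ) (K : NNReal) (a b : ℝ),
          IsOpen U ∧ p ∈ U ∧ LipschitzWith K g ∧ a < b ∧
          e '' (S ∩ U) = (fun t => pt t (g t)) '' Set.Ioo a b) ∧
      (p ∈ semiSet S r →
        ∃ (e : E2 ≃ᵃⁱ[ℝ] E2) (U : Set E2) (g : ℝ → ℝ) (K : NNReal) (a b : ℝ),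
          IsOpen U ∧ p ∈ U ∧ LipschitzWith K g ∧ a < b ∧
          e '' (S ∩ U) = (fun t => pt t (g t)) '' Set.Ico a b ∧
          e p = pt a (g a)) := by
  have hdiff : ∀ x, 0 < infDist x S → infDist x S < rS →
      DifferentiableAt ℝ (fun x => infDist x S) x := by
    intro x hx0 hxr
    have hopen : IsOpen {x | 0 < infDist x S ∧ infDist x S < rS} :=
      (isOpen_lt continuous_const (continuous_infDist_pt S)).inter
        (isOpen_lt (continuous_infDist_pt S) continuous_const)
    exact (hprox.differentiableOn one_ne_zero).differentiableAt (hopen.mem_nhds ⟨hx0, hxr⟩)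
  have h : UniformNormals S r := fun p hp w c hw =>
    mem_proxNormals_of_inner_le hcl hdiff hr.1 hr.2 hp hw
  intro p hp
  obtain ⟨q₀, hq₀, hq₀p⟩ : ∃ q ∈ S, q ≠ p := by
    by_contra! hc
    exact hnotsing ⟨p, eq_singleton_iff_unique_mem.2 ⟨hp, hc⟩⟩
  obtain ⟨b, ρ, c, hρ, hc, hcρ, h1, h2, hcone, hshape⟩ :=
    exists_frame_and_shape hr.1 hcl h hint hconn.isPreconnected hp hq₀ hq₀p
  obtain ⟨e, U, g, hU, hpU, hg, hep, heq⟩ := exists_local_graph_of_shape hp hρ hc hcone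
  have hpρ : ‖p - p‖ < ρ := by simpa using hρ
  rcases hshape with hs | hs <;> rw [hs] at heq
  · refine ⟨fun _ => ⟨e, U, g, 1, -c, c, hU, hpU, hg, by linarith, heq⟩, fun hsemi => ?_⟩
    refine absurd hsemi (notMem_semiSet_of_twoSided hr.1 h h1 h2 hc fun x hx => ?_)
    obtain ⟨⟨q, hq, hqρ, hqx⟩, -⟩ := hs.symm ▸ hx
    exact ⟨q, hq, hqx, hqx ▸ hcone p hp hpρ q hq hqρ⟩
  · refine ⟨fun hsemi => absurd ?_ hsemi, fun _ => ⟨e, U, g, 1, 0, c, hU, hpU, hg, hc, heq, hep⟩⟩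
    refine mem_semiSet_of_neg_mem hr.1 h hp h1 h2 ?_
      (exists_notMem_proxNormals hr.1 hconn.isPreconnected hp hq₀ hq₀p)
    refine neg_basis_zero_mem_of_nonneg hr.1 hcl h hp hc fun q hq hqc => ?_
    have hle : |⟪b 0, q - p⟫| < c := by
      have h3 := abs_real_inner_le_norm (b 0) (q - p)
      rw [b.norm_eq_one, one_mul] at h3
      exact h3.trans_lt hqc
    have h3 : ⟪b 0, q - p⟫ ∈ Ico 0 c := hs ▸ ⟨⟨q, hq, by linarith, rfl⟩, abs_lt.1 hle⟩
    exact h3.1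
end
end

section
/- Let S ⊆ ℝ² satisfy (H1) and let r ∈ (0, r_S). Then the set S* := {p ∈ S : C_r(p) is a closed semicircumference of ∂B_r(p)} has no accumulation points; in particular S* is discrete and, if S is compact, S* is finite. -/
open Metric Set Real
open scoped RealInnerProductSpace

noncomputable section

/-- Points at distance `r` from `p` on the boundary of the `r`-tube are centres of open balls
missing `S`. -/
lemma two_mul_inner_le_of_mem_contactSet {S : Set E2} {r : ℝ} {p n q : E2} (hr : 0 < r)
    (hn : ‖n‖ = 1) (h : p + r • n ∈ contactSet S r p) (hq : q ∈ S) :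
    2 * r * ⟪q - p, n⟫ ≤ ‖q - p‖ ^ 2 := by
  have h1 : infDist (p + r • n) S = r :=
    frontier_lt_subset_eq (continuous_infDist_pt S) continuous_const h.2
  have h2 : r ≤ dist (p + r • n) q := h1.ge.trans (infDist_le_dist_of_mem hq)
  rw [dist_comm, dist_eq_norm, show q - (p + r • n) = (q - p) - r • n by abel] at h2
  have h3 := norm_sub_sq_real (q - p) (r • n)
  rw [norm_smul, hn, inner_smul_right, Real.norm_of_nonneg hr.le] at h3
  nlinarith

/-- The Parseval identity for an orthonormal pair in the plane. -/
lemma inner_eq_of_orthonormal_pair {u v : E2} (hu : ‖u‖ = 1) (hv : ‖v‖ = 1) (huv : ⟪u, v⟫ = 0)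
    (x y : E2) : ⟪x, y⟫ = ⟪x, u⟫ * ⟪y, u⟫ + ⟪x, v⟫ * ⟪y, v⟫ := by
  have ho : Orthonormal ℝ ![u, v] := by
    simp [orthonormal_vecCons_iff, hu, hv, huv]
  let b := (basisOfOrthonormalOfCardEqFinrank ho (by simp)).toOrthonormalBasis (by simpa using ho)
  have h := b.sum_inner_mul_inner x y
  simp only [Fin.sum_univ_two, b, Module.Basis.coe_toOrthonormalBasis,
    coe_basisOfOrthonormalOfCardEqFinrank] at h
  simpa [real_inner_comm] using h.symm

/-- Seen from a point of `S*`, two nearby points of `S` make an angle smaller than `π / 3`, so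
the side joining them is not the longest side of the triangle. -/
lemma dist_lt_max_of_mem_semiSet {S : Set E2} {r : ℝ} {p q s : E2} (hr : 0 < r)
    (hp : p ∈ semiSet S r) (hq : q ∈ S) (hs : s ∈ S) (hqp : q ≠ p) (hsp : s ≠ p)
    (hdq : dist q p ≤ r / 2) (hds : dist s p ≤ r / 2) :
    dist q s < max (dist q p) (dist s p) := by
  obtain ⟨-, u, v, hu, hv, huv, hA⟩ := hp
  rw [mul_div_cancel_right₀ _ hr.ne'] at hA
  have key : ∀ w ∈ S, w ≠ p → dist w p ≤ r / 2 → 0 < ‖w - p‖ ∧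
      |⟪w - p, u⟫| ≤ ‖w - p‖ / 4 ∧ ⟪w - p, v⟫ ≤ -(4 / 5) * ‖w - p‖ := by
    intro w hw hwp hd
    rw [dist_eq_norm] at hd
    have hpos : 0 < ‖w - p‖ := norm_pos_iff.2 (sub_ne_zero.2 hwp)
    have hsq := inner_eq_of_orthonormal_pair hu hv huv (w - p) (w - p)
    rw [real_inner_self_eq_norm_sq] at hsq
    have bound : ∀ n : E2, ‖n‖ = 1 → p + r • n ∈ contactSet S r p →
        ⟪w - p, n⟫ ≤ ‖w - p‖ / 4 := by
      intro n hn h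
      have := two_mul_inner_le_of_mem_contactSet hr hn h hw
      by_contra! hlt
      nlinarith
    have h1 := bound u hu (hA ▸ ⟨0, ⟨le_rfl, pi_pos.le⟩, by simp⟩)
    have h2 := bound (-u) (by simpa) (hA ▸ ⟨π, ⟨pi_pos.le, le_rfl⟩, by simp⟩)
    have h3 := bound v hv (hA ▸ ⟨π / 2, ⟨by positivity, by linarith [pi_pos]⟩, by simp⟩)
    rw [inner_neg_right] at h2
    refine ⟨hpos, abs_le.2 ⟨by linarith, h1⟩, ?_⟩
    by_contra! hlt
    nlinarith
  obtain ⟨hq0, hq1, hq2⟩ := key q hq hqp hdq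
  obtain ⟨hs0, hs1, hs2⟩ := key s hs hsp hds
  have hin := inner_eq_of_orthonormal_pair hu hv huv (q - p) (s - p)
  have hb : (4 / 5 * ‖q - p‖) * (4 / 5 * ‖s - p‖) ≤ ⟪q - p, v⟫ * ⟪s - p, v⟫ := by
    rw [← neg_mul_neg ⟪q - p, v⟫]
    exact mul_le_mul (by linarith) (by linarith) (by positivity) (by nlinarith)
  have ha : -(‖q - p‖ / 4 * (‖s - p‖ / 4)) ≤ ⟪q - p, u⟫ * ⟪s - p, u⟫ := by
    refine (neg_le_neg ?_).trans (neg_abs_le _)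
    rw [abs_mul]
    exact mul_le_mul hq1 hs1 (abs_nonneg _) (by positivity)
  have hsub := norm_sub_sq_real (q - p) (s - p)
  rw [sub_sub_sub_cancel_right] at hsub
  have hprod : 0 < ‖q - p‖ * ‖s - p‖ := mul_pos hq0 hs0
  simp only [dist_eq_norm]
  rw [lt_max_iff]
  by_contra! h
  nlinarith [mul_nonneg (norm_nonneg (q - s)) (sub_nonneg.2 h.1),
    mul_nonneg (norm_nonneg (q - s)) (sub_nonneg.2 h.2), norm_nonneg (q - s),
    mul_self_nonneg (‖q - p‖ - ‖s - p‖),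
    mul_nonneg hq0.le (sub_nonneg.2 h.1), mul_nonneg hq0.le (sub_nonneg.2 h.2),
    mul_nonneg hs0.le (sub_nonneg.2 h.1), mul_nonneg hs0.le (sub_nonneg.2 h.2)]

/-- A ball of radius `r / 4` contains at most two points of `S*`. -/
lemma finite_semiSet_inter_ball {S : Set E2} {r : ℝ} (hr : 0 < r) (x : E2) :
    (ball x (r / 4) ∩ semiSet S r).Finite := by
  by_contra hinf
  obtain ⟨t, ht, hcard⟩ := Set.Infinite.exists_subset_card_eq hinf 3
  obtain ⟨a, b, c, hab, hac, hbc, rfl⟩ := Finset.card_eq_three.1 hcard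
  have hsmall : ∀ y ∈ ball x (r / 4) ∩ semiSet S r, ∀ z ∈ ball x (r / 4) ∩ semiSet S r,
      dist y z ≤ r / 2 := fun y hy z hz => by
    linarith [dist_triangle_right y z x, mem_ball.1 hy.1, mem_ball.1 hz.1]
  have ha := ht (show a ∈ _ by simp)
  have hb := ht (show b ∈ _ by simp)
  have hc := ht (show c ∈ _ by simp)
  have h1 := dist_lt_max_of_mem_semiSet hr ha.2 hb.2.1 hc.2.1 hab.symm hac.symm
    (hsmall b hb a ha) (hsmall c hc a ha)
  have h2 := dist_lt_max_of_mem_semiSet hr hb.2 ha.2.1 hc.2.1 hab hbc.symm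
    (hsmall a ha b hb) (hsmall c hc b hb)
  have h3 := dist_lt_max_of_mem_semiSet hr hc.2 ha.2.1 hb.2.1 hac hbc
    (hsmall a ha c hc) (hsmall b hb c hc)
  rw [dist_comm b a, dist_comm c a] at h1
  rw [dist_comm c b] at h2
  rw [lt_max_iff] at h1 h2 h3
  grind

/-- **Lemma.** Let `S ⊆ ℝ²` be nonempty, closed, connected, with empty interior, and
proximally `C¹` of radius `r_S > 0`, and let `r ∈ (0, r_S)`. Then the set
`S* := {p ∈ S : C_r(p) is a closed semicircumference}` has no accumulation points; in
particular `S*` is discrete and, if `S` is compact, `S*` is finite. -/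
theorem stmt17 (S : Set E2) (rS : ℝ) (hrS : 0 < rS)
    (hne : S.Nonempty) (hcl : IsClosed S) (hconn : IsConnected S)
    (hint : interior S = ∅)
    (hprox : ContDiffOn ℝ 1 (fun x => infDist x S)
      {x | 0 < infDist x S ∧ infDist x S < rS})
    (r : ℝ) (hr : r ∈ Set.Ioo 0 rS) :
    (∀ x : E2, ¬ AccPt x (Filter.principal (semiSet S r))) ∧
    (∀ p ∈ semiSet S r, ∃ ε > 0, semiSet S r ∩ Metric.ball p ε ⊆ {p}) ∧
    (IsCompact S → (semiSet S r).Finite) := by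
  have hacc : ∀ x : E2, ¬ AccPt x (Filter.principal (semiSet S r)) := fun x hx =>
    Set.Infinite.of_accPt (hx.nhds_inter (ball_mem_nhds x (by linarith [hr.1])))
      (finite_semiSet_inter_ball hr.1 x)
  refine ⟨hacc, fun p _ => ?_, fun hS => ?_⟩
  · have h := hacc p
    rw [accPt_iff_nhds] at h
    push Not at h
    obtain ⟨U, hU, h⟩ := h
    obtain ⟨ε, hε, hεU⟩ := Metric.mem_nhds_iff.1 hU
    exact ⟨ε, hε, fun y hy => h y ⟨hεU hy.2, hy.1⟩⟩
  · by_contra hinf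
    obtain ⟨x, -, hx⟩ := Set.Infinite.exists_accPt_of_subset_isCompact hinf hS fun y hy => hy.1
    exact hacc x hx
end
end
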